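/- Let 1 ≤ d ≤ n be integers, H ⊂ ℝ^n closed, P(H) a good class with finite Plateau infimum, and let μ be a weak-* limit in ℝ^n ∖ H of the measures μ_j = H^d ⌐ K_j along a minimizing sequence (K_j) ⊂ P(H). Then for every x ∈ spt μ ∖ H the function r ↦ μ(B_{x,r})/r^d is monotone increasing on (0, dist(x,H)). In particular the d-dimensional density θ(x) = lim_{r→0+} μ(B_{x,r})/(ω_d r^d) exists at every x ∈ spt μ ∖ H. -/

import Mathlib

open MeasureTheory Metric Filter Set
open scoped ENNReal NNReal Topology RealInnerProductSpace

noncomputable section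

/-- Euclidean space `ℝ^n`. -/
abbrev Euc (n : ℕ) : Type := EuclideanSpace ℝ (Fin n)

/-- A set is countably `H^d`-rectifiable if, up to an `H^d`-negligible set, it can be
covered by countably many images of `C^1` maps from `ℝ^d`. -/
def CountablyRectifiable (d : ℕ) {n : ℕ} (K : Set (Euc n)) : Prop :=
  ∃ f : ℕ → (Euc d → Euc n), (∀ i, ContDiff ℝ 1 (f i)) ∧
    μH[(d : ℝ)] (K \ ⋃ i, Set.range (f i)) = 0

/-- A smooth diffeomorphism of `ℝ^n`. -/
def IsDiffeo {n : ℕ} (f : Euc n → Euc n) : Prop :=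
  ContDiff ℝ (⊤ : ℕ∞) f ∧ ∃ g : Euc n → Euc n, ContDiff ℝ (⊤ : ℕ∞) g ∧
    Function.LeftInverse g f ∧ Function.RightInverse g f

/-- The class `𝔇(x,r)`: maps equal to the identity outside `B(x,r)` which are smoothly
isotopic to the identity inside `B(x,r)`. -/
def IsotopyClass {n : ℕ} (x : Euc n) (r : ℝ) : Set (Euc n → Euc n) :=
  {φ | (∀ z ∉ ball x r, φ z = z) ∧
    ∃ lam : ℝ → Euc n → Euc n,
      ContDiff ℝ (⊤ : ℕ∞) (fun p : ℝ × Euc n => lam p.1 p.2) ∧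
      lam 0 = id ∧ lam 1 = φ ∧
      (∀ t ∈ Icc (0 : ℝ) 1, ∀ z ∉ ball x r, lam t z = z) ∧
      (∀ t ∈ Icc (0 : ℝ) 1, IsDiffeo (lam t))}

/-- The class `D(x,r)`: Lipschitz maps in the `C^0`-closure of `𝔇(x,r)`. -/
def DeformClass {n : ℕ} (x : Euc n) (r : ℝ) : Set (Euc n → Euc n) :=
  {φ | (∃ C : ℝ≥0, LipschitzWith C φ) ∧
    ∃ ψ : ℕ → (Euc n → Euc n), (∀ j, ψ j ∈ IsotopyClass x r) ∧
      TendstoUniformly ψ φ atTop}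

/-- `K` is relatively closed in `U`. -/
def RelClosedIn {n : ℕ} (U K : Set (Euc n)) : Prop :=
  K ⊆ U ∧ ∃ F : Set (Euc n), IsClosed F ∧ K = F ∩ U

/-- `inf { H^d(J) : J ∈ P, J ∖ cl B(x,r) = K ∖ cl B(x,r) }`. -/
def competInf (d : ℕ) {n : ℕ} (P : Set (Set (Euc n))) (K : Set (Euc n)) (x : Euc n)
    (r : ℝ) : ℝ≥0∞ :=
  sInf {m | ∃ J ∈ P, J \ closure (ball x r) = K \ closure (ball x r) ∧ m = μH[(d : ℝ)] J}

/-- A family `P` is a good class (for boundary `H`). -/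
def IsGoodClass (d : ℕ) {n : ℕ} (H : Set (Euc n)) (P : Set (Set (Euc n))) : Prop :=
  ∀ K ∈ P, ∀ x ∈ K, ∀ᵐ r ∂(volume : Measure ℝ),
    (0 < r ∧ ENNReal.ofReal r < EMetric.infEdist x H) →
      ∀ φ ∈ DeformClass x r, competInf d P K x r ≤ μH[(d : ℝ)] (φ '' K)

/-- The Plateau infimum `m₀ = inf {H^d(K) : K ∈ P}`. -/
def plateauInf (d : ℕ) {n : ℕ} (P : Set (Set (Euc n))) : ℝ≥0∞ := ⨅ K ∈ P, μH[(d : ℝ)] K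

/-- A minimizing sequence: `H^d(K_j) ↓ m₀`. -/
def IsMinimizingSeq (d : ℕ) {n : ℕ} (P : Set (Set (Euc n))) (Kj : ℕ → Set (Euc n)) : Prop :=
  (∀ j, Kj j ∈ P) ∧ Antitone (fun j => μH[(d : ℝ)] (Kj j)) ∧
    Tendsto (fun j => μH[(d : ℝ)] (Kj j)) atTop (𝓝 (plateauInf d P))

/-- The support of a measure. -/
def sptMeas {n : ℕ} (μ : Measure (Euc n)) : Set (Euc n) :=
  {x | ∀ r : ℝ, 0 < r → 0 < μ (ball x r)}

/-- Weak-* convergence of measures in the open set `U`. -/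
def WeakStarOn {n : ℕ} (U : Set (Euc n)) (μs : ℕ → Measure (Euc n)) (μ : Measure (Euc n)) :
    Prop :=
  ∀ f : Euc n → ℝ, Continuous f → HasCompactSupport f → tsupport f ⊆ U →
    Tendsto (fun j => ∫ z, f z ∂(μs j)) atTop (𝓝 (∫ z, f z ∂μ))

/-- The (multiplicity one) varifold associated to `K` is stationary in `U`: the first
variation of `H^d ⌐ K` along any compactly supported `C^1` vector field in `U` vanishes. -/
def StationaryIn (d : ℕ) {n : ℕ} (K U : Set (Euc n)) : Prop :=
  ∀ X : Euc n → Euc n, ContDiff ℝ 1 X → HasCompactSupport X → tsupport X ⊆ U →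
    HasDerivAt (fun t : ℝ => (μH[(d : ℝ)] ((fun z => z + t • X z) '' K)).toReal) 0 0

/-- `S` is a `d`-dimensional real analytic submanifold of `ℝ^n`. -/
def IsAnalyticSubmanifold (d : ℕ) {n : ℕ} (S : Set (Euc n)) : Prop :=
  ∀ x ∈ S, ∃ (U : Set (Euc n)) (V : Set (Euc d)) (f : Euc d → Euc n),
    IsOpen U ∧ x ∈ U ∧ IsOpen V ∧ AnalyticOnNhd ℝ f V ∧ Set.InjOn f V ∧
    (∀ y ∈ V, Function.Injective (fderiv ℝ f y)) ∧ f '' V = S ∩ U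

/-- `ω_d`, the Lebesgue measure of the unit ball of `ℝ^d`. -/
def ballVol (d : ℕ) : ℝ≥0∞ := volume (ball (0 : Euc d) 1)

/-- The `d`-dimensional density of `μ` at `x` is `θ`. -/
def HasDensityAt (d : ℕ) {n : ℕ} (μ : Measure (Euc n)) (x : Euc n) (θ : ℝ≥0∞) : Prop :=
  Tendsto (fun r : ℝ => μ (ball x r) / (ballVol d * ENNReal.ofReal r ^ d)) (𝓝[>] 0) (𝓝 θ)

/-- The blow-up `(K - x)/r`. -/
def blowup {n : ℕ} (x : Euc n) (r : ℝ) (K : Set (Euc n)) : Set (Euc n) :=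
  (fun y => r⁻¹ • (y - x)) '' K

/-- `π` is the approximate tangent plane of `K` at `x`: `π` is a `d`-dimensional subspace and
`H^d ⌐ (K-x)/r` converges weakly-* to `H^d ⌐ π` as `r → 0⁺`. -/
def HasApproxTangentPlane (d : ℕ) {n : ℕ} (K : Set (Euc n)) (x : Euc n) (π : Set (Euc n)) :
    Prop :=
  (∃ W : Submodule ℝ (Euc n), Module.finrank ℝ W = d ∧ π = (W : Set (Euc n))) ∧
  ∀ f : Euc n → ℝ, Continuous f → HasCompactSupport f →
    Tendsto (fun r : ℝ => ∫ z, f z ∂(μH[(d : ℝ)].restrict (blowup x r K))) (𝓝[>] 0)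
      (𝓝 (∫ z, f z ∂(μH[(d : ℝ)].restrict π)))

/-- The sphere `S^m`, realized as the unit sphere of `ℝ^{m+1}`. -/
def sph (m : ℕ) : Set (Euc (m + 1)) := sphere 0 1

/-- A smooth embedding of `S^{n-d}` into `ℝ^n ∖ H` (given by a smooth ambient map which is
injective and immersive on the sphere, with image avoiding `H`). -/
def IsEmbeddedSphere (n d : ℕ) (H : Set (Euc n)) (γ : Euc (n - d + 1) → Euc n) : Prop :=
  ContDiff ℝ (⊤ : ℕ∞) γ ∧ Set.InjOn γ (sph (n - d)) ∧
  (∀ y ∈ sph (n - d), ∀ v : Euc (n - d + 1), ⟪v, y⟫ = (0 : ℝ) → fderiv ℝ γ y v = 0 → v = 0) ∧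
  γ '' sph (n - d) ⊆ Hᶜ

/-- `γ` and `γ'` are smoothly isotopic embeddings of `S^{n-d}` in `ℝ^n ∖ H`. -/
def SphereIsotopic (n d : ℕ) (H : Set (Euc n)) (γ γ' : Euc (n - d + 1) → Euc n) : Prop :=
  ∃ Γ : ℝ → Euc (n - d + 1) → Euc n,
    ContDiff ℝ (⊤ : ℕ∞) (fun p : ℝ × Euc (n - d + 1) => Γ p.1 p.2) ∧
    Set.EqOn (Γ 0) γ (sph (n - d)) ∧ Set.EqOn (Γ 1) γ' (sph (n - d)) ∧
    ∀ t ∈ Icc (0 : ℝ) 1, IsEmbeddedSphere n d H (Γ t)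

/-- `C` is a family of smooth embeddings of `S^{n-d}` into `ℝ^n ∖ H` closed by isotopy. -/
def ClosedByIsotopy (n d : ℕ) (H : Set (Euc n)) (C : Set (Euc (n - d + 1) → Euc n)) : Prop :=
  (∀ γ ∈ C, IsEmbeddedSphere n d H γ) ∧
  ∀ γ ∈ C, ∀ γ' : Euc (n - d + 1) → Euc n,
    IsEmbeddedSphere n d H γ' → SphereIsotopic n d H γ γ' → γ' ∈ C

/-- `K` is a `C`-spanning set of `H`. -/
def IsSpanning (n d : ℕ) (C : Set (Euc (n - d + 1) → Euc n)) (K : Set (Euc n)) : Prop :=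
  ∀ γ ∈ C, (K ∩ γ '' sph (n - d)).Nonempty

/-- `F(H,C)`: the countably `H^d`-rectifiable relatively closed `C`-spanning sets of `H`. -/
def spanningClass (n d : ℕ) (H : Set (Euc n)) (C : Set (Euc (n - d + 1) → Euc n)) :
    Set (Set (Euc n)) :=
  {K | RelClosedIn Hᶜ K ∧ CountablyRectifiable d K ∧ IsSpanning n d C K}

/-- `Σ(H)`: Lipschitz maps homotopic to the identity through maps preserving `H`. -/
def SlidingMaps {n : ℕ} (H : Set (Euc n)) : Set (Euc n → Euc n) :=
  {φ | (∃ C : ℝ≥0, LipschitzWith C φ) ∧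
    ∃ Φ : ℝ → Euc n → Euc n, Continuous (fun p : ℝ × Euc n => Φ p.1 p.2) ∧
      Φ 0 = id ∧ Φ 1 = φ ∧ ∀ t ∈ Icc (0 : ℝ) 1, Φ t '' H ⊆ H}

/-- `A(H,K₀) = {φ(K₀) : φ ∈ Σ(H)}`. -/
def slidingClass {n : ℕ} (H K0 : Set (Euc n)) : Set (Set (Euc n)) :=
  {K | ∃ φ ∈ SlidingMaps H, K = φ '' K0}

/-- The cone competitor for `K` in `B(x,r)`. -/
def coneCompetitor {n : ℕ} (x : Euc n) (r : ℝ) (K : Set (Euc n)) : Set (Euc n) :=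
  (K \ ball x r) ∪
    {w | ∃ z ∈ K ∩ sphere x r, ∃ lam ∈ Icc (0 : ℝ) 1, w = lam • x + (1 - lam) • z}

section Hausdorff

variable {α X Y : Type*} [MetricSpace X] [MeasurableSpace X] [BorelSpace X]
  [MetricSpace Y] [MeasurableSpace Y] [BorelSpace Y]

theorem hausdorffMeasure_image_le_of_dist_le [Nonempty α] (d : ℕ) (f : α → X) (g : α → Y)
    (A : Set α) {k : ℝ} (hk : 0 ≤ k)
    (h : ∀ y ∈ A, ∀ y' ∈ A, dist (g y) (g y') ≤ k * dist (f y) (f y')) :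
    μH[(d : ℝ)] (g '' A) ≤ ENNReal.ofReal (k ^ d) * μH[(d : ℝ)] (f '' A) := by
  set s : X → α := Function.invFunOn f A
  have hs : ∀ p ∈ f '' A, s p ∈ A ∧ f (s p) = p := fun p hp =>
    ⟨Function.invFunOn_mem hp, Function.invFunOn_eq hp⟩
  have hL : LipschitzOnWith ⟨k, hk⟩ (g ∘ s) (f '' A) := by
    refine LipschitzOnWith.of_dist_le_mul fun p hp q hq => ?_
    have := h _ (hs p hp).1 _ (hs q hq).1
    rwa [(hs p hp).2, (hs q hq).2] at this
  have hsub : g '' A ⊆ (g ∘ s) '' (f '' A) := by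
    rintro _ ⟨y, hy, rfl⟩
    refine ⟨f y, mem_image_of_mem f hy, ?_⟩
    have hp := hs (f y) (mem_image_of_mem f hy)
    have := h _ hp.1 _ hy
    rw [hp.2, dist_self, mul_zero] at this
    exact dist_le_zero.1 this
  refine (measure_mono hsub).trans ((hL.hausdorffMeasure_image_le d.cast_nonneg).trans_eq ?_)
  rw [ENNReal.rpow_natCast, ENNReal.ofReal_pow hk]
  congr 2
  exact (ENNReal.ofReal_eq_coe_nnreal hk).symm

end Hausdorff

theorem measure_image_le_of_countable_cover {ι X Y : Type*} [Countable ι] [MeasurableSpace X]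
    [MeasurableSpace Y] (μ : Measure X) (ν : Measure Y) (ψ : X → Y) (c : ℝ≥0∞) (E : Set X)
    (T : ι → Set X) (hT : ∀ i, MeasurableSet (T i)) (hE : E ⊆ ⋃ i, T i)
    (h : ∀ i, ∀ E' ⊆ E ∩ T i, ν (ψ '' E') ≤ c * μ E') :
    ν (ψ '' E) ≤ c * μ E := by
  rcases isEmpty_or_nonempty ι with hι | hι
  · have : E = ∅ := by simpa using hE
    simp [this]
  obtain ⟨u, hu⟩ := exists_surjective_nat ι
  set D : ℕ → Set X := disjointed (fun k => T (u k))
  have hDm : ∀ k, MeasurableSet (D k) := fun k =>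
    MeasurableSet.disjointed (fun k => hT (u k)) k
  have hDU : ⋃ k, D k = ⋃ i, T i := by
    rw [iUnion_disjointed]
    exact hu.iUnion_comp T
  have hED : E = ⋃ k, E ∩ D k := by
    rw [← inter_iUnion, hDU, inter_eq_left.2 hE]
  have hsum : ∑' k, μ (E ∩ D k) = μ E := by
    have h1 : ∀ k, μ (E ∩ D k) = μ.restrict E (D k) := fun k => by
      rw [Measure.restrict_apply (hDm k), inter_comm]
    simp_rw [h1]
    rw [← measure_iUnion (disjoint_disjointed _) hDm, hDU,
      Measure.restrict_apply (MeasurableSet.iUnion hT), inter_eq_right.2 hE]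
  calc ν (ψ '' E) = ν (⋃ k, ψ '' (E ∩ D k)) := by rw [← image_iUnion, ← hED]
    _ ≤ ∑' k, ν (ψ '' (E ∩ D k)) := measure_iUnion_le _
    _ ≤ ∑' k, c * μ (E ∩ D k) := ENNReal.tsum_le_tsum fun k =>
        h (u k) _ (inter_subset_inter_right _ (disjointed_subset _ k))
    _ = c * μ E := by rw [ENNReal.tsum_mul_left, hsum]

/-- The linear map scaling by `b` along `e` and by `a` on the orthogonal complement of `e`. -/
def axialScaling {d : ℕ} (a b : ℝ) (e : Euc d) : Euc d →ₗ[ℝ] Euc d :=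
  a • LinearMap.id + (b - a) • (innerₛₗ ℝ e).smulRight e

theorem axialScaling_apply {d : ℕ} (a b : ℝ) (e v : Euc d) :
    axialScaling a b e v = a • v + ((b - a) * ⟪e, v⟫) • e := by
  simp [axialScaling, smul_smul]

theorem norm_axialScaling_sq {d : ℕ} (a b : ℝ) {e : Euc d} (he : ‖e‖ = 1) (v : Euc d) :
    ‖axialScaling a b e v‖ ^ 2 = a ^ 2 * ‖v‖ ^ 2 + (b ^ 2 - a ^ 2) * ⟪e, v⟫ ^ 2 := by
  rw [axialScaling_apply, norm_add_sq_real, norm_smul, norm_smul, inner_smul_left,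
    inner_smul_right, he, real_inner_comm, mul_pow, mul_pow, Real.norm_eq_abs, sq_abs,
    Real.norm_eq_abs, sq_abs]
  simp
  ring

theorem det_axialScaling {d : ℕ} (hd : 1 ≤ d) {a : ℝ} (ha : a ≠ 0) (b : ℝ) {e : Euc d}
    (he : ‖e‖ = 1) : LinearMap.det (axialScaling a b e) = a ^ (d - 1) * b := by
  have h : axialScaling a b e
      = a • LinearMap.transvection (((b - a) / a) • innerₛₗ ℝ e) e := by
    ext1 v
    rw [axialScaling_apply]
    simp only [LinearMap.smul_apply, LinearMap.transvection.apply, smul_add, smul_smul,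
      innerₛₗ_apply_apply, smul_eq_mul]
    congr 2
    field_simp
  rw [h, LinearMap.det_smul, LinearMap.transvection.det]
  simp only [finrank_euclideanSpace, Fintype.card_fin, LinearMap.smul_apply, innerₛₗ_apply_apply,
    smul_eq_mul, real_inner_self_eq_norm_sq, he]
  obtain ⟨k, rfl⟩ : ∃ k, d = k + 1 := ⟨d - 1, by omega⟩
  simp only [Nat.add_sub_cancel]
  field_simp
  ring

instance hausdorffMeasure_isAddHaar_euc (d : ℕ) :
    (μH[(d : ℝ)] : Measure (Euc d)).IsAddHaarMeasure := by
  simpa using MeasureTheory.isAddHaarMeasure_hausdorffMeasure (E := Euc d)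

theorem hausdorffMeasure_image_axialScaling {d : ℕ} (hd : 1 ≤ d) {a b : ℝ} (ha : 0 < a)
    (hb : 0 ≤ b) {e : Euc d} (he : ‖e‖ = 1) (A : Set (Euc d)) :
    μH[(d : ℝ)] (axialScaling a b e '' A)
      = ENNReal.ofReal (a ^ (d - 1) * b) * μH[(d : ℝ)] A := by
  rw [Measure.addHaar_image_linearMap, det_axialScaling hd ha.ne' b he,
    abs_of_nonneg (by positivity)]

theorem HasStrictFDerivAt.exists_nhds_norm_sub_le {X Y : Type*} [NormedAddCommGroup X]
    [NormedSpace ℝ X] [NormedAddCommGroup Y] [NormedSpace ℝ Y] {f : X → Y} {M : X →L[ℝ] Y}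
    {y₀ : X} (hf : HasStrictFDerivAt f M y₀) {θ : ℝ} (hθ : 0 < θ) :
    ∃ U ∈ 𝓝 y₀, ∀ y ∈ U, ∀ y' ∈ U, ‖f y - f y' - M (y - y')‖ ≤ θ * ‖y - y'‖ := by
  obtain ⟨U, hU, h⟩ := hf.approximates_deriv_on_nhds (c := ⟨θ, hθ.le⟩) (Or.inr hθ)
  exact ⟨U, hU, fun y hy y' hy' => h y hy y' hy'⟩

theorem exists_countable_closedBall_cover {X : Type*} [PseudoMetricSpace X]
    [SecondCountableTopology X] {S : Set X} {U : X → Set X} (hU : ∀ y ∈ S, U y ∈ 𝓝 y) :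
    ∃ t ⊆ S, t.Countable ∧ ∃ ρ : X → ℝ, (∀ y ∈ t, closedBall y (ρ y) ⊆ U y) ∧
      S ⊆ ⋃ y : t, closedBall (y : X) (ρ y) := by
  have h : ∀ y, ∃ ρ : ℝ, y ∈ S → 0 < ρ ∧ closedBall y ρ ⊆ U y := fun y => by
    by_cases hy : y ∈ S
    · obtain ⟨ρ, h0, h1⟩ := Metric.nhds_basis_closedBall.mem_iff.1 (hU y hy)
      exact ⟨ρ, fun _ => ⟨h0, h1⟩⟩
    · exact ⟨0, fun h => absurd h hy⟩
  choose ρ hρ using h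
  obtain ⟨t, htS, htc, hcov⟩ := TopologicalSpace.countable_cover_nhdsWithin
    (f := fun y => closedBall y (ρ y)) (s := S)
    (fun y hy => mem_nhdsWithin_of_mem_nhds (closedBall_mem_nhds y (hρ y hy).1))
  refine ⟨t, htS, htc, ρ, fun y hy => (hρ y (htS hy)).2, ?_⟩
  rwa [iUnion_subtype]

theorem exists_nhds_hausdorffMeasure_image_le_of_not_injective {d n : ℕ} (hd : 1 ≤ d)
    {f : Euc d → Euc n} {M : Euc d →L[ℝ] Euc n} {y₀ : Euc d} (hf : HasStrictFDerivAt f M y₀)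
    (hM : ¬ Function.Injective M) {B ε : ℝ} (hB : ‖M‖ ≤ B) (hε : 0 < ε) (hε1 : ε ≤ 1) :
    ∃ U ∈ 𝓝 y₀, ∀ A ⊆ U, μH[(d : ℝ)] (f '' A) ≤
      ENNReal.ofReal (2 ^ d * (B + 1) ^ (d - 1) * ε) * μH[(d : ℝ)] A := by
  have hB0 : 0 ≤ B := (norm_nonneg _).trans hB
  obtain ⟨e, he, hMe⟩ : ∃ e : Euc d, ‖e‖ = 1 ∧ M e = 0 := by
    rw [injective_iff_map_eq_zero] at hM
    push Not at hM
    obtain ⟨v, hv, hv0⟩ := hM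
    exact ⟨‖v‖⁻¹ • v, by rw [norm_smul, norm_inv, norm_norm, inv_mul_cancel₀ (norm_ne_zero_iff.2 hv0)],
      by rw [map_smul, hv, smul_zero]⟩
  obtain ⟨U, hU, h⟩ := hf.exists_nhds_norm_sub_le hε
  refine ⟨U, hU, fun A hA => ?_⟩
  have key : ∀ v : Euc d, ‖M v‖ + ε * ‖v‖ ≤ 2 * ‖axialScaling (B + 1) ε e v‖ := fun v => by
    have h1 := norm_axialScaling_sq (B + 1) ε he v
    have h2 : ‖v - ⟪e, v⟫ • e‖ ^ 2 = ‖v‖ ^ 2 - ⟪e, v⟫ ^ 2 := by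
      rw [norm_sub_sq_real, norm_smul, inner_smul_right, he, real_inner_comm, Real.norm_eq_abs,
        mul_one, sq_abs]
      ring
    have h3 : ‖M v‖ ≤ B * ‖v - ⟪e, v⟫ • e‖ := by
      have : M v = M (v - ⟪e, v⟫ • e) := by rw [map_sub, map_smul, hMe, smul_zero, sub_zero]
      rw [this]
      exact M.le_of_opNorm_le hB _
    have h4 : 0 ≤ ‖v - ⟪e, v⟫ • e‖ ^ 2 := sq_nonneg _
    have h5 : ‖M v‖ ≤ ‖axialScaling (B + 1) ε e v‖ := by
      refine h3.trans (abs_le_of_sq_le_sq' ?_ (norm_nonneg _)).2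
      rw [h1, mul_pow, h2]
      rw [h2] at h4
      nlinarith [mul_nonneg hB0 h4, mul_nonneg (sq_nonneg ε) (sq_nonneg ⟪e, v⟫)]
    have h6 : ε * ‖v‖ ≤ ‖axialScaling (B + 1) ε e v‖ := by
      refine (abs_le_of_sq_le_sq' ?_ (norm_nonneg _)).2
      rw [h1, mul_pow]
      rw [h2] at h4
      have : ε ^ 2 ≤ (B + 1) ^ 2 := by gcongr; linarith
      nlinarith [mul_nonneg (sub_nonneg.2 this) h4]
    linarith
  refine (hausdorffMeasure_image_le_of_dist_le d (axialScaling (B + 1) ε e) f A zero_le_two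
    fun y hy y' hy' => ?_).trans_eq ?_
  · rw [dist_eq_norm, dist_eq_norm, ← map_sub]
    refine le_trans ?_ (key (y - y'))
    have := norm_add_le (f y - f y' - M (y - y')) (M (y - y'))
    rw [sub_add_cancel] at this
    linarith [h y (hA hy) y' (hA hy')]
  · rw [hausdorffMeasure_image_axialScaling hd (by linarith) hε.le he, ← mul_assoc,
      ← ENNReal.ofReal_mul (by positivity), mul_assoc (2 ^ d : ℝ)]

theorem hausdorffMeasure_image_critical_eq_zero {d n : ℕ} (hd : 1 ≤ d) {f : Euc d → Euc n}
    (hf : ContDiff ℝ 1 f) :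
    μH[(d : ℝ)] (f '' {y | ¬ Function.Injective (fderiv ℝ f y)}) = 0 := by
  set S := {y | ¬ Function.Injective (fderiv ℝ f y)}
  have hS : S = ⋃ k : ℕ, S ∩ closedBall 0 k := by
    rw [← inter_iUnion, iUnion_closedBall_nat, inter_univ]
  rw [hS, image_iUnion, measure_iUnion_null_iff]
  intro k
  obtain ⟨B, hB⟩ := (isCompact_closedBall (0 : Euc d) k).exists_bound_of_continuousOn
    (hf.continuous_fderiv one_ne_zero).continuousOn
  have hbound : ∀ ε : ℝ, 0 < ε → ε ≤ 1 → μH[(d : ℝ)] (f '' (S ∩ closedBall 0 k)) ≤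
      ENNReal.ofReal (2 ^ d * (B + 1) ^ (d - 1) * ε) * μH[(d : ℝ)] (S ∩ closedBall 0 k) := by
    intro ε hε hε1
    have hloc : ∀ y, ∃ U : Set (Euc d), y ∈ S ∩ closedBall 0 k → U ∈ 𝓝 y ∧
        ∀ A ⊆ U, μH[(d : ℝ)] (f '' A) ≤
          ENNReal.ofReal (2 ^ d * (B + 1) ^ (d - 1) * ε) * μH[(d : ℝ)] A := fun y => by
      by_cases hy : y ∈ S ∩ closedBall 0 k
      · obtain ⟨U, hU, h⟩ := exists_nhds_hausdorffMeasure_image_le_of_not_injective hd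
          (hf.contDiffAt.hasStrictFDerivAt one_ne_zero) hy.1 (hB y hy.2) hε hε1
        exact ⟨U, fun _ => ⟨hU, h⟩⟩
      · exact ⟨∅, fun h => absurd h hy⟩
    choose U hU using hloc
    obtain ⟨t, htS, htc, ρ, hρ, hcov⟩ := exists_countable_closedBall_cover
      (fun y hy => (hU y hy).1)
    have := htc.to_subtype
    exact measure_image_le_of_countable_cover _ _ f _ _ _
      (fun y : t => isClosed_closedBall.measurableSet) hcov fun y E' hE' =>
        (hU y (htS y.2)).2 _ fun z hz => hρ y y.2 (hE' hz).2
  have hfin : μH[(d : ℝ)] (S ∩ closedBall 0 k) ≠ ⊤ :=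
    ((measure_mono inter_subset_right).trans_lt measure_closedBall_lt_top).ne
  have hlim : Tendsto (fun ε : ℝ => ENNReal.ofReal (2 ^ d * (B + 1) ^ (d - 1) * ε) *
      μH[(d : ℝ)] (S ∩ closedBall 0 k)) (𝓝[>] 0) (𝓝 0) := by
    have h0 : Tendsto (fun ε : ℝ => ENNReal.ofReal (2 ^ d * (B + 1) ^ (d - 1) * ε))
        (𝓝[>] 0) (𝓝 (ENNReal.ofReal (2 ^ d * (B + 1) ^ (d - 1) * 0))) :=
      ENNReal.tendsto_ofReal ((tendsto_id.const_mul _).mono_left nhdsWithin_le_nhds)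
    simpa using ENNReal.Tendsto.mul_const h0 (Or.inr hfin)
  refine le_antisymm (ge_of_tendsto hlim ?_) zero_le
  filter_upwards [Ioc_mem_nhdsGT (zero_lt_one' ℝ)] with ε hε using hbound ε hε.1 hε.2

theorem radial_quadratic_bound {a b η θ P Q V X p q w : ℝ} (ha : 0 < a) (hab : a ≤ b)
    (hη : 0 ≤ η) (hθ : 0 ≤ θ) (hV : 0 ≤ V) (hX : 0 ≤ X)
    (hp : 0 ≤ p) (hq : 0 ≤ q)
    (hXPQ : a ^ 2 * P ^ 2 + (b ^ 2 - a ^ 2) * Q ^ 2 ≤ X ^ 2) (hVX : b * θ * V ≤ η * X)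
    (hpP : p ≤ P + θ * V) (hqQ : q ≤ Q + θ * V)
    (hw : w ^ 2 ≤ a ^ 2 * p ^ 2 + (b ^ 2 - a ^ 2) * q ^ 2) : w ≤ (1 + η) * X := by
  have hβ : 0 ≤ b ^ 2 - a ^ 2 := by nlinarith
  have hb : 0 < b := ha.trans_le hab
  have h1 : a ^ 2 * P + (b ^ 2 - a ^ 2) * Q ≤ b * X := by
    refine (abs_le_of_sq_le_sq' ?_ (by positivity)).2
    have : (a ^ 2 * P + (b ^ 2 - a ^ 2) * Q) ^ 2
        ≤ b ^ 2 * (a ^ 2 * P ^ 2 + (b ^ 2 - a ^ 2) * Q ^ 2) := by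
      nlinarith [mul_nonneg (mul_nonneg (sq_nonneg a) hβ) (sq_nonneg (P - Q))]
    rw [mul_pow]
    exact this.trans (by gcongr)
  have hVn : 0 ≤ θ * V := by positivity
  have hp2 : p ^ 2 ≤ (P + θ * V) ^ 2 := by gcongr
  have hq2 : q ^ 2 ≤ (Q + θ * V) ^ 2 := by gcongr
  have h2 : w ^ 2 ≤ a ^ 2 * (P + θ * V) ^ 2 + (b ^ 2 - a ^ 2) * (Q + θ * V) ^ 2 :=
    hw.trans (by gcongr)
  have h3 : (b * θ * V) ^ 2 ≤ (η * X) ^ 2 := by gcongr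
  have h4 : θ * V * (a ^ 2 * P + (b ^ 2 - a ^ 2) * Q) ≤ θ * V * (b * X) := by gcongr
  have h5 : b * θ * V * X ≤ η * X * X := by gcongr
  refine (abs_le_of_sq_le_sq' ?_ (by positivity)).2
  nlinarith

theorem exists_isometric_model {d n : ℕ} {M : Euc d →L[ℝ] Euc n} (hM : Function.Injective M) :
    ∃ N : Euc d ≃ₗ[ℝ] Euc d, ∀ v, ‖N v‖ = ‖M v‖ := by
  have hfr : Module.finrank ℝ (LinearMap.range (M : Euc d →ₗ[ℝ] Euc n)) = d := by
    rw [LinearMap.finrank_range_of_inj hM]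
    simp
  let ι := ((stdOrthonormalBasis ℝ (LinearMap.range (M : Euc d →ₗ[ℝ] Euc n))).reindex
    (finCongr hfr)).repr
  exact ⟨(LinearEquiv.ofInjective (M : Euc d →ₗ[ℝ] Euc n) hM).trans ι.toLinearEquiv,
    fun v => (ι.norm_map _).trans rfl⟩

theorem exists_unit_axis {d : ℕ} (hd : 1 ≤ d) (N : Euc d ≃ₗ[ℝ] Euc d) (ℓ : Euc d →L[ℝ] ℝ)
    (hℓ : ∀ v, |ℓ v| ≤ ‖N v‖) :
    ∃ e : Euc d, ‖e‖ = 1 ∧ ∀ v, ℓ v ^ 2 ≤ ⟪e, N v⟫ ^ 2 := by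
  set m : Euc d →L[ℝ] ℝ := ℓ.comp (N.symm.toContinuousLinearEquiv : Euc d →L[ℝ] Euc d)
  set u := (InnerProductSpace.toDual ℝ (Euc d)).symm m
  have hu : ∀ v, ⟪u, N v⟫ = ℓ v := fun v => by
    rw [InnerProductSpace.toDual_symm_apply]
    change ℓ (N.symm (N v)) = ℓ v
    rw [LinearEquiv.symm_apply_apply]
  have hu1 : ‖u‖ ≤ 1 := by
    have h1 := hℓ (N.symm u)
    rw [← hu, LinearEquiv.apply_symm_apply, real_inner_self_eq_norm_sq,
      abs_of_nonneg (sq_nonneg _)] at h1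
    by_contra! h
    nlinarith
  rcases eq_or_ne u 0 with h0 | h0
  · have : Nonempty (Fin d) := ⟨⟨0, hd⟩⟩
    obtain ⟨e, he⟩ := exists_norm_eq (Euc d) zero_le_one
    refine ⟨e, he, fun v => ?_⟩
    rw [← hu, h0, inner_zero_left, zero_pow two_ne_zero]
    positivity
  · refine ⟨‖u‖⁻¹ • u, by rw [norm_smul, norm_inv, norm_norm, inv_mul_cancel₀ (norm_ne_zero_iff.2 h0)],
      fun v => ?_⟩
    rw [inner_smul_left, hu, mul_pow]
    refine le_mul_of_one_le_left (sq_nonneg _) ?_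
    have : 1 ≤ ‖u‖⁻¹ := (one_le_inv₀ (norm_pos_iff.2 h0)).2 hu1
    exact one_le_pow₀ this

/-- `ψ` expands distances radially (with respect to `x`) by at most `b` and tangentially by at
most `a` on `E`. -/
def RadialExpansionLE {n : ℕ} (x : Euc n) (a b : ℝ) (ψ : Euc n → Euc n) (E : Set (Euc n)) : Prop :=
  ∀ z ∈ E, ∀ z' ∈ E,
    ‖ψ z - ψ z'‖ ^ 2 ≤ a ^ 2 * ‖z - z'‖ ^ 2 + (b ^ 2 - a ^ 2) * (‖z - x‖ - ‖z' - x‖) ^ 2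

theorem RadialExpansionLE.exists_nhds_hausdorffMeasure_image_le {d n : ℕ} (hd : 1 ≤ d)
    {x : Euc n} {a b : ℝ} (ha : 0 < a) (hab : a ≤ b) {ψ : Euc n → Euc n} {E : Set (Euc n)}
    (hψ : RadialExpansionLE x a b ψ E) {f : Euc d → Euc n} {M : Euc d →L[ℝ] Euc n} {y₀ : Euc d}
    (hf : HasStrictFDerivAt f M y₀) (hM : Function.Injective M) (hx : f y₀ ≠ x) {η : ℝ}
    (hη : 0 < η) (hη1 : η < 1) :
    ∃ U ∈ 𝓝 y₀, ∀ A ⊆ U, f '' A ⊆ E → μH[(d : ℝ)] (ψ '' (f '' A)) ≤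
      ENNReal.ofReal (((1 + η) * (1 - η)⁻¹) ^ d * (a ^ (d - 1) * b)) * μH[(d : ℝ)] (f '' A) := by
  have hb : 0 < b := ha.trans_le hab
  obtain ⟨N, hN⟩ := exists_isometric_model hM
  obtain ⟨c, hc, hcM⟩ : ∃ c > 0, ∀ v, c * ‖v‖ ≤ ‖M v‖ := by
    obtain ⟨K, hK, hKM⟩ := (M : Euc d →ₗ[ℝ] Euc n).exists_antilipschitzWith
      (LinearMap.ker_eq_bot.2 hM)
    refine ⟨(K : ℝ)⁻¹, by positivity, fun v => ?_⟩
    have := hKM.le_mul_dist v 0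
    rw [map_zero, dist_zero_right, dist_zero_right] at this
    rw [inv_mul_le_iff₀ (by positivity)]
    exact this
  set D : Euc n →L[ℝ] ℝ := fderiv ℝ (fun z => ‖z - x‖) (f y₀)
  have hρ : HasStrictFDerivAt (fun z : Euc n => ‖z - x‖) D (f y₀) := by
    have : ContDiffAt ℝ 1 (fun z : Euc n => ‖z - x‖) (f y₀) :=
      (contDiffAt_id.sub contDiffAt_const).norm ℝ (sub_ne_zero.2 hx)
    exact this.hasStrictFDerivAt one_ne_zero
  have hD : ‖D‖ ≤ 1 := by
    have : LipschitzWith 1 (fun z : Euc n => ‖z - x‖) := by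
      refine LipschitzWith.of_dist_le_mul fun z w => ?_
      rw [Real.dist_eq, dist_eq_norm, NNReal.coe_one, one_mul]
      simpa using abs_norm_sub_norm_le (z - x) (w - x)
    exact norm_fderiv_le_of_lipschitz ℝ this
  set ℓ : Euc d →L[ℝ] ℝ := D.comp M
  have hℓM : ∀ v, |ℓ v| ≤ ‖M v‖ := fun v =>
    (D.le_of_opNorm_le hD (M v)).trans_eq (one_mul _)
  obtain ⟨e, he, hℓe⟩ := exists_unit_axis hd N ℓ fun v => (hℓM v).trans_eq (hN v).symm
  set θ := η * (a * c / b)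
  have hθ : 0 < θ := by positivity
  have hbθ : b * θ = η * (a * c) := by simp only [θ]; field_simp
  have hθc : θ ≤ η * c := by
    have : a * c / b ≤ c := by rw [div_le_iff₀ hb]; nlinarith
    exact mul_le_mul_of_nonneg_left this hη.le
  obtain ⟨U₁, hU₁, h₁⟩ := hf.exists_nhds_norm_sub_le hθ
  obtain ⟨U₂, hU₂, h₂⟩ := (hρ.comp y₀ hf).exists_nhds_norm_sub_le hθ
  refine ⟨U₁ ∩ U₂, inter_mem hU₁ hU₂, fun A hA hAE => ?_⟩
  have hNf : μH[(d : ℝ)] (N '' A) ≤ ENNReal.ofReal ((1 - η)⁻¹ ^ d) * μH[(d : ℝ)] (f '' A) := by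
    refine hausdorffMeasure_image_le_of_dist_le d f N A (inv_nonneg.2 (by linarith))
      fun y hy y' hy' => ?_
    rw [dist_eq_norm, dist_eq_norm, ← map_sub, hN, inv_mul_eq_div, le_div_iff₀ (by linarith)]
    have e1 := h₁ y (hA hy).1 y' (hA hy').1
    have e2 := norm_sub_norm_le (M (y - y')) (f y - f y')
    rw [norm_sub_rev (M (y - y'))] at e2
    have e3 := mul_le_mul_of_nonneg_right hθc (norm_nonneg (y - y'))
    have e4 := mul_le_mul_of_nonneg_left (hcM (y - y')) hη.le
    linarith
  have hψT : μH[(d : ℝ)] ((ψ ∘ f) '' A) ≤ ENNReal.ofReal ((1 + η) ^ d) *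
      μH[(d : ℝ)] ((axialScaling a b e ∘ N) '' A) := by
    refine hausdorffMeasure_image_le_of_dist_le d (axialScaling a b e ∘ N) (ψ ∘ f) A (by linarith)
      fun y hy y' hy' => ?_
    rw [dist_eq_norm, dist_eq_norm]
    simp only [Function.comp_apply]
    rw [← map_sub, ← map_sub]
    set v := y - y' with hv
    have hT := norm_axialScaling_sq a b he (N v)
    rw [hN] at hT
    have hβ : 0 ≤ b ^ 2 - a ^ 2 := by nlinarith
    have hTM : a * ‖M v‖ ≤ ‖axialScaling a b e (N v)‖ := by
      refine (abs_le_of_sq_le_sq' ?_ (norm_nonneg _)).2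
      rw [hT, mul_pow]
      exact le_add_of_nonneg_right (mul_nonneg hβ (sq_nonneg _))
    have e1 := norm_add_le (f y - f y' - M v) (M v)
    rw [sub_add_cancel] at e1
    have e2 := norm_add_le (‖f y - x‖ - ‖f y' - x‖ - ℓ v) (ℓ v)
    rw [sub_add_cancel] at e2
    have e3 := h₁ y (hA hy).1 y' (hA hy').1
    have e4 := h₂ y (hA hy).2 y' (hA hy').2
    refine radial_quadratic_bound (P := ‖M v‖) (Q := ‖ℓ v‖) ha hab hη.le hθ.le
      (norm_nonneg v) (norm_nonneg _) (norm_nonneg (f y - f y'))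
      (norm_nonneg (‖f y - x‖ - ‖f y' - x‖)) ?_ ?_ (by linarith)
      (e2.trans (by rw [add_comm]; exact add_le_add_right e4 _)) ?_
    · rw [hT, Real.norm_eq_abs, sq_abs]
      have := mul_le_mul_of_nonneg_left (hℓe v) hβ
      linarith
    · rw [hbθ]
      have := mul_le_mul_of_nonneg_left (hcM v) ha.le
      nlinarith
    · have := hψ _ (hAE (mem_image_of_mem f hy)) _ (hAE (mem_image_of_mem f hy'))
      rwa [Real.norm_eq_abs (_ - _), sq_abs]
  have hη2 : 0 ≤ (1 - η)⁻¹ := inv_nonneg.2 (by linarith)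
  rw [image_comp, image_comp, hausdorffMeasure_image_axialScaling hd ha hb.le he] at hψT
  calc μH[(d : ℝ)] (ψ '' (f '' A))
      ≤ ENNReal.ofReal ((1 + η) ^ d) * (ENNReal.ofReal (a ^ (d - 1) * b) *
        (ENNReal.ofReal ((1 - η)⁻¹ ^ d) * μH[(d : ℝ)] (f '' A))) := hψT.trans (by gcongr)
    _ = _ := by
      rw [← mul_assoc, ← mul_assoc, ← ENNReal.ofReal_mul (by positivity),
        ← ENNReal.ofReal_mul (by positivity), mul_pow, mul_right_comm]

theorem RadialExpansionLE.hausdorffMeasure_image_le {d n : ℕ} (hd : 1 ≤ d)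
    {x : Euc n} {a b : ℝ} (ha : 0 < a) (hab : a ≤ b) {ψ : Euc n → Euc n} {E : Set (Euc n)}
    (hψ : RadialExpansionLE x a b ψ E) (hxE : x ∉ E) (hE : CountablyRectifiable d E)
    (hfin : μH[(d : ℝ)] E ≠ ⊤) :
    μH[(d : ℝ)] (ψ '' E) ≤ ENNReal.ofReal (a ^ (d - 1) * b) * μH[(d : ℝ)] E := by
  have hb : 0 < b := ha.trans_le hab
  obtain ⟨f, hf, hf0⟩ := hE
  set Z := (E \ ⋃ i, range (f i)) ∪ ⋃ i, f i '' {y | ¬ Function.Injective (fderiv ℝ (f i) y)}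
  have hZ : μH[(d : ℝ)] Z = 0 := measure_union_null hf0
    (measure_iUnion_null fun i => hausdorffMeasure_image_critical_eq_zero hd (hf i))
  have hψZ : μH[(d : ℝ)] (ψ '' (E ∩ Z)) = 0 := by
    refine le_antisymm ?_ zero_le
    refine (hausdorffMeasure_image_le_of_dist_le d id ψ (E ∩ Z) hb.le
      fun z hz z' hz' => ?_).trans_eq ?_
    · rw [dist_eq_norm, dist_eq_norm]
      refine (abs_le_of_sq_le_sq' ?_ (by positivity)).2
      have h1 := hψ z hz.1 z' hz'.1
      have h2 : (‖z - x‖ - ‖z' - x‖) ^ 2 ≤ ‖z - z'‖ ^ 2 := by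
        refine sq_le_sq' ?_ ?_
        · have := norm_sub_norm_le (z' - x) (z - x)
          rw [sub_sub_sub_cancel_right, norm_sub_rev z' z] at this
          linarith
        · have := norm_sub_norm_le (z - x) (z' - x)
          rwa [sub_sub_sub_cancel_right] at this
      have hβ : 0 ≤ b ^ 2 - a ^ 2 := by nlinarith
      have := mul_le_mul_of_nonneg_left h2 hβ
      simp only [id, mul_pow]
      linarith
    · rw [image_id, measure_mono_null inter_subset_right hZ, mul_zero]
  have hη : ∀ η : ℝ, 0 < η → η < 1 → μH[(d : ℝ)] (ψ '' E) ≤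
      ENNReal.ofReal (((1 + η) * (1 - η)⁻¹) ^ d * (a ^ (d - 1) * b)) * μH[(d : ℝ)] E := by
    intro η hη hη1
    have hsplit : ψ '' E = ψ '' (E ∩ Z) ∪ ψ '' (E \ Z) := by
      rw [← image_union, inter_union_sdiff]
    rw [hsplit]
    refine (measure_union_le _ _).trans ?_
    rw [hψZ, zero_add]
    refine le_trans ?_ (mul_le_mul_right (measure_mono (sdiff_subset (s := E) (t := Z))) _)
    refine measure_image_le_of_countable_cover _ _ ψ _ _ (fun i => range (f i)) (fun i => ?_) ?_
      fun i E' hE' => ?_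
    · rw [← image_univ, ← iUnion_closedBall_nat (0 : Euc d), image_iUnion]
      exact MeasurableSet.iUnion fun k =>
        ((isCompact_closedBall _ _).image (hf i).continuous).measurableSet
    · intro z hz
      by_contra h
      exact hz.2 (Or.inl ⟨hz.1, h⟩)
    · set S := {y | f i y ∈ E'}
      have hloc : ∀ y, ∃ U : Set (Euc d), y ∈ S → U ∈ 𝓝 y ∧
          ∀ A ⊆ U, f i '' A ⊆ E → μH[(d : ℝ)] (ψ '' (f i '' A)) ≤
            ENNReal.ofReal (((1 + η) * (1 - η)⁻¹) ^ d * (a ^ (d - 1) * b)) *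
              μH[(d : ℝ)] (f i '' A) := fun y => by
        by_cases hy : y ∈ S
        · have hyE := hE' hy
          have hinj : Function.Injective (fderiv ℝ (f i) y) := by
            by_contra h
            exact hyE.1.2 (Or.inr (mem_iUnion.2 ⟨i, y, h, rfl⟩))
          obtain ⟨U, hU, h⟩ := hψ.exists_nhds_hausdorffMeasure_image_le hd ha hab
            ((hf i).contDiffAt.hasStrictFDerivAt one_ne_zero) hinj
            (fun h => hxE (h ▸ hyE.1.1)) hη hη1
          exact ⟨U, fun _ => ⟨hU, h⟩⟩
        · exact ⟨∅, fun h => absurd h hy⟩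
      choose U hU using hloc
      obtain ⟨t, htS, htc, ρ, hρ, hcov⟩ := exists_countable_closedBall_cover
        (fun y hy => (hU y hy).1)
      have := htc.to_subtype
      refine measure_image_le_of_countable_cover _ _ ψ _ _
        (fun y : t => f i '' closedBall (y : Euc d) (ρ y)) (fun y =>
          ((isCompact_closedBall _ _).image (hf i).continuous).measurableSet) ?_
          fun y E'' hE'' => ?_
      · intro z hz
        obtain ⟨y, rfl⟩ := (hE' hz).2
        obtain ⟨w, hw⟩ := mem_iUnion.1 (hcov hz)
        exact mem_iUnion.2 ⟨w, mem_image_of_mem _ hw⟩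
      · have himg : f i '' (closedBall (y : Euc d) (ρ y) ∩ f i ⁻¹' E'') = E'' := by
          rw [image_inter_preimage, inter_eq_right]
          exact fun z hz => (hE'' hz).2
        have := (hU y (htS y.2)).2 (closedBall (y : Euc d) (ρ y) ∩ f i ⁻¹' E'')
          (inter_subset_left.trans (hρ y y.2))
          (himg.symm ▸ fun z hz => (hE' (hE'' hz).1).1.1)
        rwa [himg] at this
  have hlim : Tendsto (fun η : ℝ =>
      ENNReal.ofReal (((1 + η) * (1 - η)⁻¹) ^ d * (a ^ (d - 1) * b)) * μH[(d : ℝ)] E)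
      (𝓝[>] 0) (𝓝 (ENNReal.ofReal (a ^ (d - 1) * b) * μH[(d : ℝ)] E)) := by
    refine ENNReal.Tendsto.mul_const (ENNReal.tendsto_ofReal ?_) (Or.inr hfin)
    have h0 : ContinuousAt (fun η : ℝ => ((1 + η) * (1 - η)⁻¹) ^ d * (a ^ (d - 1) * b)) 0 := by
      refine ContinuousAt.mul (ContinuousAt.pow (ContinuousAt.mul (by fun_prop)
        (ContinuousAt.inv₀ (by fun_prop) (by norm_num))) _) continuousAt_const
    have := h0.tendsto.mono_left (nhdsWithin_le_nhds (s := Ioi 0))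
    simpa using this
  refine ge_of_tendsto hlim ?_
  filter_upwards [Ioo_mem_nhdsGT (zero_lt_one' ℝ)] with η h using hη η h.1 h.2

theorem exists_smooth_step {η : ℝ} (hη : 0 < η) :
    ∃ S : ℝ → ℝ, ContDiff ℝ (⊤ : ℕ∞) S ∧ Monotone S ∧ (∀ t ≤ 0, S t = 0) ∧ (∀ t, 1 ≤ t → S t = 1) ∧
      ∀ t t', |S t - S t'| ≤ (1 + η) * |t - t'| := by
  have hlt : (2 * (1 + η))⁻¹ < 1 / 2 := by
    rw [one_div]
    exact inv_strictAnti₀ two_pos (by linarith)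
  let β : ContDiffBump (1 / 2 : ℝ) := ⟨(2 * (1 + η))⁻¹, 1 / 2, by positivity, hlt⟩
  set g : ℝ → ℝ := β.normed volume with hg
  have hgs : ContDiff ℝ (⊤ : ℕ∞) g := β.contDiff_normed
  have hsupp : Function.support g = Ioo 0 1 := by
    rw [hg, β.support_normed_eq, Real.ball_eq_Ioo]
    norm_num [β]
  have hg0 : ∀ t, 0 ≤ g t := fun t => β.nonneg_normed t
  have hg1 : ∀ t, g t ≤ 1 + η := fun t => by
    refine (β.normed_le_div_measure_closedBall_rIn volume t).trans_eq ?_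
    rw [Real.volume_real_closedBall β.rIn_pos.le]
    simp only [β]
    field_simp
  have hd : ∀ t, HasDerivAt (fun t => ∫ s in (0 : ℝ)..t, g s) (g t) t := fun t =>
    hgs.continuous.integral_hasStrictDerivAt 0 t |>.hasDerivAt
  have hderiv : deriv (fun t => ∫ s in (0 : ℝ)..t, g s) = g := funext fun t => (hd t).deriv
  refine ⟨fun t => ∫ s in (0 : ℝ)..t, g s, ?_, ?_, fun t ht => ?_, fun t ht => ?_, fun t t' => ?_⟩
  · rw [contDiff_infty_iff_deriv, hderiv]
    exact ⟨fun t => (hd t).differentiableAt, hgs⟩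
  · exact monotone_of_deriv_nonneg (fun t => (hd t).differentiableAt) fun t => by
      rw [hderiv]; exact hg0 t
  · change ∫ s in (0 : ℝ)..t, g s = 0
    rw [intervalIntegral.integral_congr (g := fun _ => (0 : ℝ)), intervalIntegral.integral_zero]
    intro s hs
    rw [uIcc_of_ge ht] at hs
    by_contra h
    have : s ∈ Function.support g := h
    rw [hsupp] at this
    linarith [this.1, hs.2]
  · change ∫ s in (0 : ℝ)..t, g s = 1
    rw [intervalIntegral.integral_eq_integral_of_support_subset, hg, β.integral_normed]
    rw [hsupp]
    exact fun s hs => ⟨hs.1, hs.2.le.trans ht⟩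
  · change |(∫ s in (0 : ℝ)..t, g s) - ∫ s in (0 : ℝ)..t', g s| ≤ _
    rw [intervalIntegral.integral_interval_sub_left (hgs.continuous.intervalIntegrable _ _)
      (hgs.continuous.intervalIntegrable _ _), ← Real.norm_eq_abs]
    exact intervalIntegral.norm_integral_le_of_norm_le_const fun s _ => by
      rw [Real.norm_eq_abs, abs_of_nonneg (hg0 s)]; exact hg1 s

theorem IsDiffeo.of_le_norm_sub {n : ℕ} {f : Euc n → Euc n} (hf : ContDiff ℝ (⊤ : ℕ∞) f) {c : ℝ}
    (hc : 0 < c) (h : ∀ z z', c * ‖z - z'‖ ≤ ‖f z - f z'‖) : IsDiffeo f := by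
  have hanti : AntilipschitzWith ⟨c⁻¹, inv_nonneg.2 hc.le⟩ f :=
    AntilipschitzWith.of_le_mul_dist fun z z' => by
      rw [dist_eq_norm, dist_eq_norm]
      change ‖z - z'‖ ≤ c⁻¹ * ‖f z - f z'‖
      rw [le_inv_mul_iff₀ hc]
      exact h z z'
  have hstrict : ∀ z, HasStrictFDerivAt f (fderiv ℝ f z) z := fun z =>
    hf.contDiffAt.hasStrictFDerivAt (by simp)
  have hinj : ∀ z, Function.Injective (fderiv ℝ f z) := fun z => by
    rw [injective_iff_map_eq_zero]
    intro w hw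
    obtain ⟨U, hU, hUf⟩ := (hstrict z).exists_nhds_norm_sub_le (half_pos hc)
    have hcont : Tendsto (fun ε : ℝ => z + ε • w) (𝓝[>] 0) (𝓝 z) := by
      have : ContinuousAt (fun ε : ℝ => z + ε • w) 0 := by fun_prop
      have := this.tendsto.mono_left (nhdsWithin_le_nhds (s := Ioi 0))
      simpa using this
    obtain ⟨ε, hεU, hε⟩ := ((hcont.eventually_mem hU).and self_mem_nhdsWithin).exists
    have h1 := hUf _ hεU _ (mem_of_mem_nhds hU)
    have h2 := h (z + ε • w) z
    rw [add_sub_cancel_left, map_smul, hw, smul_zero, sub_zero] at h1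
    rw [add_sub_cancel_left] at h2
    have h3 : ‖ε • w‖ = 0 := by nlinarith [norm_nonneg (ε • w)]
    rw [norm_eq_zero, smul_eq_zero] at h3
    exact h3.resolve_left (ne_of_gt hε)
  let e : Euc n → (Euc n ≃L[ℝ] Euc n) := fun z =>
    (LinearEquiv.ofInjectiveEndo (fderiv ℝ f z : Euc n →ₗ[ℝ] Euc n) (hinj z)).toContinuousLinearEquiv
  have he : ∀ z, (e z : Euc n →L[ℝ] Euc n) = fderiv ℝ f z := fun z => by
    ext1 v
    rfl
  have hopen : IsOpenMap f := isOpenMap_of_hasStrictFDerivAt_equiv (f' := e) fun z => by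
    rw [he]; exact hstrict z
  have hclosed : IsClosed (range f) := by
    have : IsProperMap f := by
      rw [isProperMap_iff_tendsto_cocompact]
      refine ⟨hf.continuous, ?_⟩
      rw [← Metric.cobounded_eq_cocompact]
      exact hanti.tendsto_cobounded
    exact this.isClosedMap.isClosed_range
  have hsurj : Function.Surjective f := by
    rw [← range_eq_univ]
    exact IsClopen.eq_univ ⟨hclosed, hopen.isOpen_range⟩ (range_nonempty f)
  let F : Euc n ≃ₜ Euc n := (Equiv.ofBijective f ⟨hanti.injective, hsurj⟩).toHomeomorphOfContinuousOpen
    hf.continuous hopen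
  refine ⟨hf, F.symm, F.contDiff_symm (f₀' := e) (fun z => ?_) hf, F.left_inv, F.right_inv⟩
  rw [he]
  exact (hstrict z).hasFDerivAt

/-- The map scaling each sphere around `y` of radius `s` by the factor `p s`. -/
def radialMap {n : ℕ} (y : Euc n) (p : ℝ → ℝ) (z : Euc n) : Euc n := y + p ‖z - y‖ • (z - y)

theorem norm_radialMap_sub_sq {n : ℕ} (y : Euc n) (p : ℝ → ℝ) (z z' : Euc n) :
    ‖radialMap y p z - radialMap y p z'‖ ^ 2 =
      (p ‖z - y‖ * ‖z - y‖ - p ‖z' - y‖ * ‖z' - y‖) ^ 2 +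
      p ‖z - y‖ * p ‖z' - y‖ * (‖z - z'‖ ^ 2 - (‖z - y‖ - ‖z' - y‖) ^ 2) := by
  have h : ‖z - z'‖ ^ 2 = ‖z - y‖ ^ 2 - 2 * ⟪z - y, z' - y⟫ + ‖z' - y‖ ^ 2 := by
    rw [← norm_sub_sq_real, sub_sub_sub_cancel_right]
  rw [radialMap, radialMap, add_sub_add_left_eq_sub, norm_sub_sq_real, norm_smul, norm_smul,
    inner_smul_left, inner_smul_right, h, Real.norm_eq_abs, Real.norm_eq_abs, mul_pow, mul_pow,
    sq_abs, sq_abs]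
  simp only [conj_trivial]
  ring

theorem sq_norm_sub_sub_le {n : ℕ} (y z z' : Euc n) :
    (‖z - y‖ - ‖z' - y‖) ^ 2 ≤ ‖z - z'‖ ^ 2 := by
  rw [← sq_abs]
  have := abs_norm_sub_norm_le (z - y) (z' - y)
  rw [sub_sub_sub_cancel_right] at this
  gcongr

/-- A smooth radial profile, equal to `κ` near the centre, to `1` beyond radius `r`, and
`L`-Lipschitz. -/
structure IsRadialProfile (κ s₀ r L : ℝ) (p : ℝ → ℝ) : Prop where
  contDiff : ContDiff ℝ (⊤ : ℕ∞) p
  monotone : Monotone p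
  eq_inner : ∀ s ≤ s₀, p s = κ
  eq_outer : ∀ s, r ≤ s → p s = 1
  abs_sub_le : ∀ s s', |p s - p s'| ≤ L * |s - s'|

namespace IsRadialProfile

variable {κ s₀ r L : ℝ} {p : ℝ → ℝ}

theorem le_one (hp : IsRadialProfile κ s₀ r L p) (s : ℝ) : p s ≤ 1 :=
  (hp.monotone (le_max_left s r)).trans_eq (hp.eq_outer _ (le_max_right s r))

theorem le_apply (hp : IsRadialProfile κ s₀ r L p) (s : ℝ) : κ ≤ p s :=
  (hp.eq_inner _ (min_le_right s s₀)).symm.trans_le (hp.monotone (min_le_left s s₀))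

theorem abs_mul_sub_mul_le (hp : IsRadialProfile κ s₀ r L p) (hκ : 0 ≤ κ) (hr : 0 ≤ r)
    (hL : 0 ≤ L) {s s' : ℝ} (hs : 0 ≤ s) (hs' : 0 ≤ s') :
    |p s * s - p s' * s'| ≤ (1 + r * L) * |s - s'| := by
  have h1 : |p s| ≤ 1 := abs_le.2 ⟨by linarith [hp.le_apply s], hp.le_one s⟩
  have h2 : |p s * s - p s' * s'| ≤ |p s| * |s - s'| + |p s - p s'| * s' := by
    have := abs_add_le (p s * (s - s')) ((p s - p s') * s')
    rw [abs_mul, abs_mul, abs_of_nonneg hs'] at this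
    refine le_trans (le_of_eq ?_) this
    ring_nf
  have h3 : |p s| * |s - s'| ≤ 1 * |s - s'| := by gcongr
  rcases le_total r s' with h | h
  · rcases le_total r s with h' | h'
    · rw [hp.eq_outer s h', hp.eq_outer s' h, one_mul, one_mul]
      nlinarith [abs_nonneg (s - s'), mul_nonneg hr hL]
    · have h4 : |p s * s - p s' * s'| ≤ |p s'| * |s - s'| + |p s - p s'| * r := by
        have := abs_add_le (p s' * (s - s')) ((p s - p s') * s)
        rw [abs_mul, abs_mul, abs_of_nonneg hs] at this
        have h5 : |p s - p s'| * s ≤ |p s - p s'| * r := by gcongr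
        refine le_trans (le_of_eq ?_) (this.trans (by linarith))
        ring_nf
      rw [hp.eq_outer s' h, abs_one] at h4
      have h5 := mul_le_mul_of_nonneg_right (hp.abs_sub_le s s') hr
      rw [hp.eq_outer s' h] at h5
      rw [hp.eq_outer s' h]
      linarith
  · have h5 := mul_le_mul (hp.abs_sub_le s s') h hs' (by positivity)
    linarith

theorem radialExpansionLE (hp : IsRadialProfile κ s₀ r L p) (hκ : 0 ≤ κ) (hr : 0 ≤ r)
    (hL : 0 ≤ L) {n : ℕ} (y : Euc n) {a : ℝ} {E : Set (Euc n)} (hE : ∀ z ∈ E, p ‖z - y‖ ≤ a) :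
    RadialExpansionLE y a (1 + r * L) (radialMap y p) E := by
  intro z hz z' hz'
  rw [norm_radialMap_sub_sq]
  have h1 := hp.abs_mul_sub_mul_le hκ hr hL (norm_nonneg (z - y)) (norm_nonneg (z' - y))
  have h2 := pow_le_pow_left₀ (abs_nonneg _) h1 2
  rw [sq_abs, mul_pow, sq_abs] at h2
  have h0 := hκ.trans (hp.le_apply ‖z' - y‖)
  have h3 : p ‖z - y‖ * p ‖z' - y‖ ≤ a * a :=
    mul_le_mul (hE z hz) (hE z' hz') h0 ((hκ.trans (hp.le_apply _)).trans (hE z hz))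
  have h4 := mul_le_mul_of_nonneg_right h3 (sub_nonneg.2 (sq_norm_sub_sub_le y z z'))
  nlinarith

theorem norm_radialMap_sub_le (hp : IsRadialProfile κ s₀ r L p) (hκ : 0 ≤ κ) (hr : 0 ≤ r)
    (hL : 0 ≤ L) {n : ℕ} (y z z' : Euc n) :
    ‖radialMap y p z - radialMap y p z'‖ ≤ (1 + r * L) * ‖z - z'‖ := by
  have h := hp.radialExpansionLE hκ hr hL y (a := 1) (E := univ) (fun z _ => hp.le_one _)
    z trivial z' trivial
  have h1 := sq_norm_sub_sub_le y z z'
  have hb : (0 : ℝ) ≤ (1 + r * L) ^ 2 - 1 ^ 2 := by nlinarith [mul_nonneg hr hL]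
  refine (abs_le_of_sq_le_sq' ?_ (by positivity)).2
  nlinarith [mul_le_mul_of_nonneg_left h1 hb]

theorem contDiff_comp_norm (hp : IsRadialProfile κ s₀ r L p) (hs₀ : 0 < s₀) {n : ℕ} (y : Euc n) :
    ContDiff ℝ (⊤ : ℕ∞) fun z : Euc n => p ‖z - y‖ := by
  rw [contDiff_iff_contDiffAt]
  intro z
  rcases eq_or_ne z y with rfl | hz
  · refine (contDiffAt_const (c := κ)).congr_of_eventuallyEq ?_
    filter_upwards [ball_mem_nhds z hs₀] with w hw
    exact hp.eq_inner _ (by rw [← dist_eq_norm]; exact (mem_ball.1 hw).le)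
  · exact hp.contDiff.contDiffAt.comp z
      ((contDiffAt_id.sub contDiffAt_const).norm ℝ (sub_ne_zero.2 hz))

theorem mem_deformClass (hp : IsRadialProfile κ s₀ r L p) (hκ : 0 < κ) (hs₀ : 0 < s₀)
    (hr : 0 ≤ r) (hL : 0 ≤ L) {n : ℕ} (y : Euc n) : radialMap y p ∈ DeformClass y r := by
  have hfix : ∀ z ∉ ball y r, p ‖z - y‖ = 1 := fun z hz =>
    hp.eq_outer _ (by rwa [mem_ball, not_lt, dist_eq_norm] at hz)
  have hiso : radialMap y p ∈ IsotopyClass y r := by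
    refine ⟨fun z hz => by simp [radialMap, hfix z hz],
      fun t => radialMap y (fun s => 1 - t + t * p s), ?_, ?_, ?_, ?_, ?_⟩
    · have := (hp.contDiff_comp_norm hs₀ y).comp (contDiff_snd (E := ℝ))
      have h2 : ContDiff ℝ (⊤ : ℕ∞) fun q : ℝ × Euc n => y + (1 - q.1 + q.1 * p ‖q.2 - y‖) •
          (q.2 - y) :=
        contDiff_const.add (((contDiff_const.sub contDiff_fst).add (contDiff_fst.mul this)).smul
          (contDiff_snd.sub contDiff_const))
      exact h2
    · funext z
      simp [radialMap]
    · funext z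
      simp [radialMap]
    · intro t _ z hz
      simp [radialMap, hfix z hz]
    · intro t ht
      have hsm : ContDiff ℝ (⊤ : ℕ∞) (radialMap y (fun s => 1 - t + t * p s)) :=
        contDiff_const.add ((contDiff_const.add (contDiff_const.mul
          (hp.contDiff_comp_norm hs₀ y))).smul (contDiff_id.sub contDiff_const))
      have hκ1 : κ ≤ 1 := (hp.le_apply 0).trans (hp.le_one 0)
      set q : ℝ → ℝ := fun s => 1 - t + t * p s with hq
      have hqκ : ∀ s, κ ≤ q s := fun s => by
        have := hp.le_apply s
        simp only [hq]
        nlinarith [ht.1, ht.2]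
      have hqm : Monotone q := fun s s' hss => by
        have := mul_le_mul_of_nonneg_left (hp.monotone hss) ht.1
        simp only [hq]
        linarith
      have hgrow : ∀ s s', 0 ≤ s' → s' ≤ s → κ * (s - s') ≤ q s * s - q s' * s' :=
        fun s s' h0 h1 => by
          nlinarith [mul_nonneg h0 (sub_nonneg.2 (hqm h1)),
            mul_nonneg (sub_nonneg.2 h1) (sub_nonneg.2 (hqκ s))]
      refine IsDiffeo.of_le_norm_sub hsm hκ fun z z' => ?_
      refine (abs_le_of_sq_le_sq' ?_ (norm_nonneg _)).2
      rw [norm_radialMap_sub_sq]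
      have h1 : (κ * (‖z - y‖ - ‖z' - y‖)) ^ 2 ≤
          (q ‖z - y‖ * ‖z - y‖ - q ‖z' - y‖ * ‖z' - y‖) ^ 2 := by
        rcases le_total ‖z' - y‖ ‖z - y‖ with h | h
        · have := hgrow _ _ (norm_nonneg _) h
          have h0 : 0 ≤ κ * (‖z - y‖ - ‖z' - y‖) := mul_nonneg hκ.le (sub_nonneg.2 h)
          gcongr
        · have := hgrow _ _ (norm_nonneg _) h
          have h0 : 0 ≤ κ * (‖z' - y‖ - ‖z - y‖) := mul_nonneg hκ.le (sub_nonneg.2 h)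
          rw [← neg_sq, ← neg_sq (q _ * _ - _), neg_sub, ← mul_neg, neg_sub]
          gcongr
      have h2 : κ * κ ≤ q ‖z - y‖ * q ‖z' - y‖ :=
        mul_le_mul (hqκ _) (hqκ _) hκ.le (hκ.le.trans (hqκ _))
      have h3 := mul_le_mul_of_nonneg_right h2 (sub_nonneg.2 (sq_norm_sub_sub_le y z z'))
      nlinarith
  refine ⟨⟨⟨1 + r * L, by positivity⟩, LipschitzWith.of_dist_le_mul fun z z' => ?_⟩,
    fun _ => radialMap y p, fun _ => hiso, fun u hu =>
      Eventually.of_forall fun _ _ => refl_mem_uniformity hu⟩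
  rw [dist_eq_norm, dist_eq_norm]
  exact hp.norm_radialMap_sub_le hκ.le hr hL y z z'

end IsRadialProfile

theorem exists_isRadialProfile {η κ δ r : ℝ} (hη : 0 < η) (hκ : 0 ≤ κ) (hκ1 : κ ≤ 1)
    (hδ : 0 < δ) (hr : 0 < r) :
    ∃ p, IsRadialProfile κ ((1 - δ) * r) r ((1 + η) / (δ * r)) p ∧
      ∀ t, 0 ≤ t → p ((1 - δ) * r + t * (δ * r)) ≤ κ + (1 + η) * t := by
  obtain ⟨S, hS, hmono, h0, h1, hLip⟩ := exists_smooth_step hη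
  have hδr : 0 < δ * r := by positivity
  have hS0 : ∀ t, 0 ≤ S t := fun t => by
    rw [← h0 _ (min_le_right t 0)]
    exact hmono (min_le_left t 0)
  refine ⟨fun s => κ + (1 - κ) * S ((s - (1 - δ) * r) / (δ * r)), ⟨?_, ?_, ?_, ?_, ?_⟩, ?_⟩
  · exact contDiff_const.add (contDiff_const.mul
      (hS.comp ((contDiff_id.sub contDiff_const).div_const _)))
  · intro s s' h
    have : S ((s - (1 - δ) * r) / (δ * r)) ≤ S ((s' - (1 - δ) * r) / (δ * r)) :=
      hmono (by gcongr)
    have := mul_le_mul_of_nonneg_left this (sub_nonneg.2 hκ1)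
    simpa using this
  · intro s hs
    rw [h0 _ (div_nonpos_of_nonpos_of_nonneg (by linarith) hδr.le)]
    ring
  · intro s hs
    rw [h1 _ (by rw [le_div_iff₀ hδr]; linarith)]
    ring
  · intro s s'
    have h2 := hLip ((s - (1 - δ) * r) / (δ * r)) ((s' - (1 - δ) * r) / (δ * r))
    rw [← sub_div, sub_sub_sub_cancel_right, abs_div, abs_of_pos hδr] at h2
    rw [add_sub_add_left_eq_sub, ← mul_sub, abs_mul, abs_of_nonneg (sub_nonneg.2 hκ1)]
    refine (mul_le_of_le_one_left (abs_nonneg _) (by linarith)).trans (h2.trans_eq ?_)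
    ring
  · intro t ht
    change κ + (1 - κ) * S (((1 - δ) * r + t * (δ * r) - (1 - δ) * r) / (δ * r)) ≤ _
    rw [add_sub_cancel_left, mul_div_cancel_right₀ _ hδr.ne']
    have h2 := hLip t 0
    rw [h0 0 le_rfl, sub_zero, sub_zero, abs_of_nonneg (hS0 t), abs_of_nonneg ht] at h2
    nlinarith [hS0 t]

theorem CountablyRectifiable.mono {d n : ℕ} {K E : Set (Euc n)} (hK : CountablyRectifiable d K)
    (hE : E ⊆ K) : CountablyRectifiable d E := by
  obtain ⟨f, hf, h0⟩ := hK
  exact ⟨f, hf, measure_mono_null (sdiff_subset_sdiff_left hE) h0⟩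

theorem plateauInf_le_competInf {d n : ℕ} (P : Set (Set (Euc n))) (K : Set (Euc n)) (y : Euc n)
    (r : ℝ) : plateauInf d P ≤ competInf d P K y r :=
  le_sInf fun _ ⟨_, hJ, _, hm⟩ => hm ▸ iInf₂_le _ hJ

/-- The `H^d`-mass of `K` in the ball `B(y,s)`, as a real number. -/
def ballMass (d : ℕ) {n : ℕ} (K : Set (Euc n)) (y : Euc n) (s : ℝ) : ℝ :=
  (μH[(d : ℝ)] (K ∩ ball y s)).toReal

section BallMass

variable {d n : ℕ} {K : Set (Euc n)}

theorem ofReal_ballMass (hK : μH[(d : ℝ)] K ≠ ⊤) (y : Euc n) (s : ℝ) :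
    ENNReal.ofReal (ballMass d K y s) = μH[(d : ℝ)] (K ∩ ball y s) :=
  ENNReal.ofReal_toReal (measure_ne_top_of_subset inter_subset_left hK)

theorem ballMass_nonneg (y : Euc n) (s : ℝ) : 0 ≤ ballMass d K y s := ENNReal.toReal_nonneg

theorem ballMass_monotone (hK : μH[(d : ℝ)] K ≠ ⊤) (y : Euc n) : Monotone (ballMass d K y) :=
  fun _ _ h => ENNReal.toReal_mono (measure_ne_top_of_subset inter_subset_left hK)
    (measure_mono (inter_subset_inter_right _ (ball_subset_ball h)))

theorem hausdorffMeasure_shell (hK : μH[(d : ℝ)] K ≠ ⊤) (y : Euc n) {s s' : ℝ} (h : s ≤ s') :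
    μH[(d : ℝ)] ((K ∩ ball y s') \ ball y s) =
      ENNReal.ofReal (ballMass d K y s' - ballMass d K y s) := by
  have h1 := measure_inter_add_sdiff (μ := μH[(d : ℝ)]) (K ∩ ball y s')
    (measurableSet_ball (x := y) (ε := s))
  rw [inter_assoc, inter_eq_right.2 (ball_subset_ball h), ← ofReal_ballMass hK, add_comm,
    ← ofReal_ballMass hK] at h1
  rw [ENNReal.ofReal_sub _ (ballMass_nonneg y s), ← h1,
    ENNReal.add_sub_cancel_right ENNReal.ofReal_ne_top]

/-- A set which almost minimizes `H^d` cannot lose much mass in `B(y,r)` under a deformation. -/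
theorem measure_inter_ball_le_of_competInf_le {P : Set (Set (Euc n))} (hK : μH[(d : ℝ)] K ≠ ⊤)
    {ε : ℝ≥0∞} (hε : μH[(d : ℝ)] K ≤ plateauInf d P + ε) {y : Euc n} {r : ℝ}
    {φ : Euc n → Euc n} (hφ : ∀ z ∉ ball y r, φ z = z)
    (hc : competInf d P K y r ≤ μH[(d : ℝ)] (φ '' K)) :
    μH[(d : ℝ)] (K ∩ ball y r) ≤ μH[(d : ℝ)] (φ '' (K ∩ ball y r)) + ε := by
  have h1 : φ '' K ⊆ φ '' (K ∩ ball y r) ∪ K \ ball y r := by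
    rintro _ ⟨z, hz, rfl⟩
    by_cases hzb : z ∈ ball y r
    · exact Or.inl ⟨z, ⟨hz, hzb⟩, rfl⟩
    · exact Or.inr (by rw [hφ z hzb]; exact ⟨hz, hzb⟩)
  have h2 : μH[(d : ℝ)] (K ∩ ball y r) + μH[(d : ℝ)] (K \ ball y r) ≤
      μH[(d : ℝ)] (φ '' (K ∩ ball y r)) + ε + μH[(d : ℝ)] (K \ ball y r) := by
    rw [measure_inter_add_sdiff _ measurableSet_ball, add_right_comm]
    refine hε.trans ?_
    gcongr
    exact (plateauInf_le_competInf P K y r).trans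
      (hc.trans ((measure_mono h1).trans (measure_union_le _ _)))
  exact (ENNReal.add_le_add_iff_right (measure_ne_top_of_subset sdiff_subset hK)).1 h2

theorem ball_subset_ball_union_shells (y : Euc n) (s : ℕ → ℝ) (N : ℕ) :
    ball y (s N) ⊆ ball y (s 0) ∪ ⋃ i ∈ Finset.range N, ball y (s (i + 1)) \ ball y (s i) := by
  induction N with
  | zero => exact subset_union_left
  | succ N ih =>
    intro z hz
    by_cases h : z ∈ ball y (s N)
    · rcases ih h with h | h
      · exact Or.inl h
      · refine Or.inr ?_
        simp only [mem_iUnion, Finset.mem_range] at h ⊢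
        obtain ⟨i, hi, h⟩ := h
        exact ⟨i, by omega, h⟩
    · refine Or.inr ?_
      simp only [mem_iUnion, Finset.mem_range]
      exact ⟨N, by omega, hz, h⟩

theorem IsRadialProfile.hausdorffMeasure_image_inter_ball_le (hd : 1 ≤ d)
    (hrect : CountablyRectifiable d K) (hK : μH[(d : ℝ)] K ≠ ⊤) {y : Euc n} {κ s₀ r L : ℝ}
    {p : ℝ → ℝ} (hp : IsRadialProfile κ s₀ r L p) (hκ : 0 < κ) (hs₀ : 0 < s₀) (hr : 0 ≤ r)
    (hL : 0 ≤ L) (s : ℕ → ℝ) (hs : Monotone s) (h0 : s 0 = s₀) (N : ℕ) (hN : s N = r)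
    (a : ℕ → ℝ) (ha : ∀ i, p (s (i + 1)) ≤ a i) (hab : ∀ i < N, a i ≤ 1 + r * L) :
    μH[(d : ℝ)] (radialMap y p '' (K ∩ ball y r)) ≤
      ENNReal.ofReal (κ ^ d * ballMass d K y s₀ + ∑ i ∈ Finset.range N,
        a i ^ (d - 1) * (1 + r * L) * (ballMass d K y (s (i + 1)) - ballMass d K y (s i))) := by
  have ha0 : ∀ i, 0 < a i := fun i => (hκ.trans_le (hp.le_apply _)).trans_le (ha i)
  have hb0 : 0 ≤ 1 + r * L := by positivity
  have hcover : radialMap y p '' (K ∩ ball y r) ⊆ radialMap y p '' (K ∩ ball y s₀) ∪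
      ⋃ i ∈ Finset.range N, radialMap y p '' ((K ∩ ball y (s (i + 1))) \ ball y (s i)) := by
    simp only [← image_iUnion, ← image_union]
    refine image_mono fun z hz => ?_
    rcases ball_subset_ball_union_shells y s N (hN ▸ hz.2) with h | h
    · exact Or.inl ⟨hz.1, h0 ▸ h⟩
    · simp only [mem_iUnion] at h
      obtain ⟨i, hi, h⟩ := h
      refine Or.inr ?_
      simp only [mem_iUnion]
      exact ⟨i, hi, ⟨hz.1, h.1⟩, h.2⟩
  have hdiff : ∀ i, 0 ≤ ballMass d K y (s (i + 1)) - ballMass d K y (s i) := fun i =>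
    sub_nonneg.2 (ballMass_monotone hK y (hs i.le_succ))
  have hterm : ∀ i, 0 ≤ a i ^ (d - 1) * (1 + r * L) *
      (ballMass d K y (s (i + 1)) - ballMass d K y (s i)) := fun i =>
    mul_nonneg (mul_nonneg (pow_nonneg (ha0 i).le _) hb0) (hdiff i)
  rw [ENNReal.ofReal_add (mul_nonneg (pow_nonneg hκ.le _) (ballMass_nonneg _ _))
    (Finset.sum_nonneg fun i _ => hterm i), ENNReal.ofReal_sum_of_nonneg fun i _ => hterm i]
  refine (measure_mono hcover).trans ((measure_union_le _ _).trans (add_le_add ?_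
    ((measure_biUnion_finset_le _ _).trans (Finset.sum_le_sum fun i hi => ?_))))
  · have hmap : ∀ z ∈ K ∩ ball y s₀, radialMap y p z = y + κ • (z - y) := fun z hz => by
      rw [radialMap, hp.eq_inner _ (by rw [← dist_eq_norm]; exact (mem_ball.1 hz.2).le)]
    rw [ENNReal.ofReal_mul (pow_nonneg hκ.le _), ofReal_ballMass hK]
    refine (hausdorffMeasure_image_le_of_dist_le d id (radialMap y p) (K ∩ ball y s₀) hκ.le
      fun z hz z' hz' => ?_).trans_eq (by rw [image_id])
    rw [hmap z hz, hmap z' hz', dist_eq_norm, add_sub_add_left_eq_sub, ← smul_sub,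
      sub_sub_sub_cancel_right, norm_smul, Real.norm_of_nonneg hκ.le, dist_eq_norm, id, id]
  · rw [ENNReal.ofReal_mul (mul_nonneg (pow_nonneg (ha0 i).le _) hb0),
      ← hausdorffMeasure_shell hK y (hs i.le_succ)]
    refine (hp.radialExpansionLE hκ.le hr hL y fun z hz => ?_).hausdorffMeasure_image_le hd
      (ha0 i) (hab i (Finset.mem_range.1 hi)) (fun hy => hy.2 (mem_ball_self ?_))
      (hrect.mono (sdiff_subset.trans inter_subset_left))
      (measure_ne_top_of_subset (sdiff_subset.trans inter_subset_left) hK)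
    · refine (hp.monotone ?_).trans (ha i)
      rw [← dist_eq_norm]
      exact (mem_ball.1 hz.1.2).le
    · exact hs₀.trans_le (h0 ▸ hs (Nat.zero_le i))

theorem ballMass_le_of_competInf_le (hd : 1 ≤ d) {P : Set (Set (Euc n))}
    (hrect : CountablyRectifiable d K) (hK : μH[(d : ℝ)] K ≠ ⊤) {ε : ℝ} (hε0 : 0 ≤ ε)
    (hε : μH[(d : ℝ)] K ≤ plateauInf d P + ENNReal.ofReal ε) {y : Euc n} {r : ℝ} (hr : 0 < r)
    (hc : ∀ φ ∈ DeformClass y r, competInf d P K y r ≤ μH[(d : ℝ)] (φ '' K))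
    {η δ : ℝ} (hη : 0 < η) (hδ : 0 < δ) (hδ1 : δ < 1) {N : ℕ} (hN : 0 < N) :
    ballMass d K y r ≤ ε + δ * ballMass d K y r + ∑ i ∈ Finset.range N,
      (δ + (1 + η) * ((i + 1 : ℕ) / N)) ^ (d - 1) * (δ + (1 + η)) * (δ⁻¹ *
        (ballMass d K y (r + δ * (r * ((i + 1 : ℕ) / N - 1))) -
          ballMass d K y (r + δ * (r * (i / N - 1))))) := by
  have hN0 : (0 : ℝ) < N := by exact_mod_cast hN
  obtain ⟨p, hp, hpt⟩ := exists_isRadialProfile hη hδ.le hδ1.le hδ hr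
  set s : ℕ → ℝ := fun i => r + δ * (r * (i / N - 1)) with hs
  have hL : 0 ≤ (1 + η) / (δ * r) := by positivity
  have hs₀ : 0 < (1 - δ) * r := mul_pos (by linarith) hr
  have hb : 1 + r * ((1 + η) / (δ * r)) = (δ + (1 + η)) * δ⁻¹ := by field_simp
  have hle := hp.hausdorffMeasure_image_inter_ball_le hd hrect hK (y := y) hδ hs₀ hr.le hL s
    (fun i j hij => by simp only [hs]; gcongr) (by simp only [hs]; push_cast; ring) N
    (by simp only [hs]; rw [div_self hN0.ne']; ring)
    (fun i => δ + (1 + η) * ((i + 1 : ℕ) / N))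
    (fun i => by
      convert hpt ((i + 1 : ℕ) / N) (by positivity) using 2
      simp only [hs]
      ring)
    (fun i hi => by
      have h1 : ((i + 1 : ℕ) : ℝ) / N ≤ 1 := by
        rw [div_le_one hN0]
        exact_mod_cast hi
      have h2 : 1 ≤ δ⁻¹ := (one_le_inv₀ hδ).2 hδ1.le
      rw [hb, add_mul δ, mul_inv_cancel₀ hδ.ne']
      exact add_le_add hδ1.le (mul_le_mul_of_nonneg_left (h1.trans h2) (by positivity)))
  have hmem := hp.mem_deformClass hδ hs₀ hr.le hL y
  have hfix : ∀ z ∉ ball y r, radialMap y p z = z := fun z hz => by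
    rw [radialMap, hp.eq_outer _ (by rwa [mem_ball, not_lt, dist_eq_norm] at hz), one_smul,
      add_sub_cancel]
  have h1 := measure_inter_ball_le_of_competInf_le hK hε hfix (hc _ hmem)
  have hmono := ballMass_monotone (d := d) hK y
  set X := ∑ i ∈ Finset.range N, (δ + (1 + η) * ((i + 1 : ℕ) / N)) ^ (d - 1) *
    (1 + r * ((1 + η) / (δ * r))) * (ballMass d K y (s (i + 1)) - ballMass d K y (s i)) with hX
  have hX0 : 0 ≤ X := Finset.sum_nonneg fun i _ => mul_nonneg (by positivity) (sub_nonneg.2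
    (hmono (by simp only [hs]; gcongr; exact i.le_succ)))
  have hin0 : 0 ≤ δ ^ d * ballMass d K y ((1 - δ) * r) :=
    mul_nonneg (by positivity) (ballMass_nonneg _ _)
  have h2 := h1.trans (add_le_add_left hle _)
  rw [← ofReal_ballMass hK, ← ENNReal.ofReal_add (add_nonneg hin0 hX0) hε0,
    ENNReal.ofReal_le_ofReal_iff (by positivity)] at h2
  have h3 : δ ^ d * ballMass d K y ((1 - δ) * r) ≤ δ * ballMass d K y r :=
    mul_le_mul (pow_le_of_le_one hδ.le hδ1.le (by omega)) (hmono (by nlinarith))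
      (ballMass_nonneg _ _) hδ.le
  have h4 : X = ∑ i ∈ Finset.range N,
      (δ + (1 + η) * ((i + 1 : ℕ) / N)) ^ (d - 1) * (δ + (1 + η)) * (δ⁻¹ *
        (ballMass d K y (s (i + 1)) - ballMass d K y (s i))) :=
    Finset.sum_congr rfl fun i _ => by rw [hb]; ring
  rw [h4] at h2
  simp only [hs] at h2
  linarith

theorem natCast_mul_sum_pow_le (d N : ℕ) :
    (d : ℝ) * ∑ i ∈ Finset.range N, ((i + 1 : ℕ) : ℝ) ^ (d - 1) ≤ ((N + 1 : ℕ) : ℝ) ^ d := by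
  induction N with
  | zero => simp
  | succ N ih =>
    rw [Finset.sum_range_succ, mul_add]
    have h : (d : ℝ) * ((N + 1 : ℕ) : ℝ) ^ (d - 1) ≤
        ((N + 1 + 1 : ℕ) : ℝ) ^ d - ((N + 1 : ℕ) : ℝ) ^ d := by
      rcases Nat.eq_zero_or_pos d with rfl | hd
      · simp
      have h1 := one_add_mul_le_pow (a := (((N + 1 : ℕ) : ℝ))⁻¹)
        (by have : (0 : ℝ) ≤ ((N + 1 : ℕ) : ℝ)⁻¹ := by positivity
            linarith) d
      have h0 : (0 : ℝ) < ((N + 1 : ℕ) : ℝ) := by positivity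
      have h2 := mul_le_mul_of_nonneg_right h1 (pow_nonneg h0.le d)
      rw [← mul_pow, add_mul, add_mul, inv_mul_cancel₀ h0.ne', one_mul, one_mul] at h2
      have h3 : (d : ℝ) * (((N + 1 : ℕ) : ℝ))⁻¹ * ((N + 1 : ℕ) : ℝ) ^ d =
          (d : ℝ) * ((N + 1 : ℕ) : ℝ) ^ (d - 1) := by
        obtain ⟨m, rfl⟩ : ∃ m, d = m + 1 := ⟨d - 1, by omega⟩
        rw [Nat.add_sub_cancel, pow_succ]
        field_simp
      rw [h3] at h2
      push_cast at h2 ⊢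
      linarith
    linarith

theorem natCast_mul_ballMass_sub_le (hd : 1 ≤ d) {P : Set (Set (Euc n))}
    (hrect : CountablyRectifiable d K) (hK : μH[(d : ℝ)] K ≠ ⊤) {ε : ℝ} (hε0 : 0 ≤ ε)
    (hε : μH[(d : ℝ)] K ≤ plateauInf d P + ENNReal.ofReal ε) {y : Euc n} {r : ℝ} (hr : 0 < r)
    (hc : ∀ φ ∈ DeformClass y r, competInf d P K y r ≤ μH[(d : ℝ)] (φ '' K)) {m : ℝ}
    (hm : HasDerivAt (ballMass d K y) m r) :
    d * (ballMass d K y r - ε) ≤ r * m := by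
  have hm0 : 0 ≤ m := hm.deriv ▸ (ballMass_monotone hK y).deriv_nonneg
  have hlin : ∀ c : ℝ, HasDerivAt (fun δ : ℝ => ballMass d K y (r + δ * c)) (m * c) 0 := fun c => by
    have h1 : HasDerivAt (fun δ : ℝ => r + δ * c) c 0 := by
      simpa using ((hasDerivAt_id (0 : ℝ)).mul_const c).const_add r
    have h2 : HasDerivAt (ballMass d K y) m (r + 0 * c) := by simpa using hm
    exact h2.comp 0 h1
  have hη : ∀ N : ℕ, 0 < N → ∀ η : ℝ, 0 < η → ballMass d K y r ≤ ε + ∑ i ∈ Finset.range N,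
      ((1 + η) * ((i + 1 : ℕ) / N)) ^ (d - 1) * (1 + η) * (r / N * m) := fun N hN η hη => by
    have hid : Tendsto (fun δ : ℝ => δ) (𝓝[>] 0) (𝓝 0) := nhdsWithin_le_nhds
    have hlim : Tendsto (fun δ : ℝ => ε + δ * ballMass d K y r + ∑ i ∈ Finset.range N,
        (δ + (1 + η) * ((i + 1 : ℕ) / N)) ^ (d - 1) * (δ + (1 + η)) * (δ⁻¹ *
        (ballMass d K y (r + δ * (r * ((i + 1 : ℕ) / N - 1))) -
          ballMass d K y (r + δ * (r * (i / N - 1)))))) (𝓝[>] 0)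
        (𝓝 (ε + 0 * ballMass d K y r + ∑ i ∈ Finset.range N,
          (0 + (1 + η) * ((i + 1 : ℕ) / N)) ^ (d - 1) * (0 + (1 + η)) * (r / N * m))) := by
      refine ((hid.mul_const _).const_add _).add (tendsto_finsetSum _ fun i _ =>
        (((hid.add_const _).pow _).mul (hid.add_const _)).mul ?_)
      have h1 := ((hlin (r * ((i + 1 : ℕ) / N - 1))).sub
        (hlin (r * (i / N - 1)))).tendsto_slope_zero_right
      convert h1 using 2
      · simp
      · push_cast
        ring
    have := ge_of_tendsto hlim (by
      filter_upwards [Ioo_mem_nhdsGT one_pos] with δ hδ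
      exact ballMass_le_of_competInf_le hd hrect hK hε0 hε hr hc hη hδ.1 hδ.2 hN)
    simpa only [zero_mul, add_zero, zero_add] using this
  have hN : ∀ N : ℕ, 0 < N → d * (ballMass d K y r - ε) ≤ (1 + 1 / (N : ℝ)) ^ d * (r * m) :=
    fun N hN => by
    have hN0 : (0 : ℝ) < N := by exact_mod_cast hN
    have hcont : Continuous fun η : ℝ => ε + ∑ i ∈ Finset.range N,
      ((1 + η) * ((i + 1 : ℕ) / N)) ^ (d - 1) * (1 + η) * (r / N * m) := by fun_prop
    have h1 := ge_of_tendsto (hcont.tendsto 0 |>.mono_left (nhdsWithin_le_nhds (s := Ioi 0))) (by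
      filter_upwards [self_mem_nhdsWithin] with η h using hη N hN η h)
    simp only [add_zero, one_mul, mul_one, ← Finset.sum_mul, div_pow, ← Finset.sum_div] at h1
    have h2 : (d : ℝ) * (ballMass d K y r - ε) ≤ d * ((∑ i ∈ Finset.range N,
        ((i + 1 : ℕ) : ℝ) ^ (d - 1)) / (N : ℝ) ^ (d - 1) * (r / N * m)) := by
      gcongr
      linarith
    refine h2.trans ?_
    have h3 : (1 + 1 / (N : ℝ)) ^ d = ((N + 1 : ℕ) : ℝ) ^ d / N ^ d := by
      rw [← div_pow]
      push_cast
      congr 1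
      field_simp
    have h4 : (N : ℝ) ^ d = N ^ (d - 1) * N := by rw [← pow_succ, Nat.sub_add_cancel hd]
    calc (d : ℝ) * ((∑ i ∈ Finset.range N, ((i + 1 : ℕ) : ℝ) ^ (d - 1)) / (N : ℝ) ^ (d - 1) *
          (r / N * m)) =
        (d * ∑ i ∈ Finset.range N, ((i + 1 : ℕ) : ℝ) ^ (d - 1)) / N ^ d * (r * m) := by
          rw [h4]; field_simp
      _ ≤ _ := by
          rw [h3]
          gcongr
          exact natCast_mul_sum_pow_le d N
  have hlim : Tendsto (fun N : ℕ => (1 + 1 / (N : ℝ)) ^ d * (r * m)) atTop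
      (𝓝 ((1 + 0) ^ d * (r * m))) :=
    ((tendsto_one_div_atTop_nhds_zero_nat.const_add 1).pow d).mul_const _
  have := ge_of_tendsto hlim (by filter_upwards [eventually_gt_atTop 0] with N h using hN N h)
  simpa using this

end BallMass

theorem pow_mul_sub_le_of_ae_deriv {f : ℝ → ℝ} (hf : Monotone f) {a b ε : ℝ} (ha : 0 < a)
    (hab : a ≤ b) (hpos : ε < f a) (d : ℕ)
    (h : ∀ᵐ r, r ∈ Icc a b → ∀ m, HasDerivAt f m r → d * (f r - ε) ≤ r * m) :
    b ^ d * (f a - ε) ≤ a ^ d * (f b - ε) := by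
  have hb : 0 < b := ha.trans_le hab
  have hpos' : ∀ r, a ≤ r → 0 < f r - ε := fun r hr => by linarith [hf hr]
  set g : ℝ → ℝ := fun r => Real.log (f r - ε) with hg
  have hmono : MonotoneOn g (uIcc a b) := by
    rw [uIcc_of_le hab]
    intro s hs s' _ hss
    exact Real.log_le_log (hpos' s hs.1) (by linarith [hf hss])
  have hint := hmono.intervalIntegrable_deriv
  have hle := hmono.intervalIntegral_deriv_mem_uIcc
  rw [uIcc_of_le (sub_nonneg.2 (hmono left_mem_uIcc right_mem_uIcc hab))] at hle
  have hinv : IntervalIntegrable (fun r : ℝ => d * r⁻¹) volume a b := by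
    refine (intervalIntegral.intervalIntegrable_inv (fun r hr => ?_)
      continuousOn_id).const_mul _
    rw [uIcc_of_le hab] at hr
    exact (ha.trans_le hr.1).ne'
  have hcmp : ∫ r in a..b, d * r⁻¹ ≤ ∫ r in a..b, deriv g r := by
    refine intervalIntegral.integral_mono_ae_restrict hab hinv hint ?_
    rw [EventuallyLE, ae_restrict_iff' measurableSet_Icc]
    filter_upwards [h, hf.ae_differentiableAt] with r hr hdiff hrab
    have hr0 : 0 < r := ha.trans_le hrab.1
    have h1 := hr hrab _ hdiff.hasDerivAt
    have h2 := hpos' r hrab.1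
    have h3 : deriv g r = deriv f r / (f r - ε) :=
      ((hdiff.hasDerivAt.sub_const ε).log h2.ne').deriv
    rw [h3, ← div_eq_mul_inv, div_le_div_iff₀ hr0 h2]
    linarith
  rw [intervalIntegral.integral_const_mul, integral_inv_of_pos ha hb] at hcmp
  have hlog := hcmp.trans hle.2
  rw [Real.log_div hb.ne' ha.ne'] at hlog
  have hfa := hpos' a le_rfl
  have hfb := hpos' b hab
  refine (Real.log_le_log_iff (by positivity) (by positivity)).1 ?_
  rw [Real.log_mul (by positivity) hfa.ne', Real.log_mul (by positivity) hfb.ne', Real.log_pow,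
    Real.log_pow]
  simp only [hg] at hlog
  linarith

/-- Almost monotonicity of the mass ratios of an almost minimizer. -/
theorem IsGoodClass.ballMass_le {d n : ℕ} (hd : 1 ≤ d) {H : Set (Euc n)} {P : Set (Set (Euc n))}
    (hgood : IsGoodClass d H P) {K : Set (Euc n)} (hKP : K ∈ P)
    (hrect : CountablyRectifiable d K) (hK : μH[(d : ℝ)] K ≠ ⊤) {ε : ℝ} (hε0 : 0 ≤ ε)
    (hε : μH[(d : ℝ)] K ≤ plateauInf d P + ENNReal.ofReal ε) {y : Euc n} (hy : y ∈ K) {a b : ℝ}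
    (ha : 0 < a) (hab : a ≤ b) (hb : ENNReal.ofReal b < infEDist y H) :
    ballMass d K y a ≤ ε + (a / b) ^ d * ballMass d K y b := by
  have hb0 : 0 < b := ha.trans_le hab
  have hfb : 0 ≤ ballMass d K y b := ballMass_nonneg y b
  rcases le_or_gt (ballMass d K y a) ε with h | h
  · exact h.trans (le_add_of_nonneg_right (by positivity))
  · have h1 := pow_mul_sub_le_of_ae_deriv (ballMass_monotone hK y) ha hab h d (by
      filter_upwards [hgood K hKP y hy] with r hr hrab m hm
      have hr0 : 0 < r := ha.trans_le hrab.1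
      exact natCast_mul_ballMass_sub_le hd hrect hK hε0 hε hr0
        (hr ⟨hr0, (ENNReal.ofReal_le_ofReal hrab.2).trans_lt hb⟩) hm)
    have h2 : ballMass d K y a - ε ≤ (a / b) ^ d * (ballMass d K y b - ε) := by
      rw [div_pow, div_mul_eq_mul_div, le_div_iff₀ (by positivity)]
      linarith
    have h3 : (a / b) ^ d * (ballMass d K y b - ε) ≤ (a / b) ^ d * ballMass d K y b := by
      gcongr
      linarith
    linarith

theorem ContDiffBump.integrable_of_measure_ball_ne_top {n : ℕ} {x : Euc n} (χ : ContDiffBump x)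
    (ν : Measure (Euc n)) (hν : ν (ball x χ.rOut) ≠ ⊤) : Integrable χ ν := by
  have h1 : Integrable ((ball x χ.rOut).indicator fun _ => (1 : ℝ)) ν :=
    (integrable_indicator_iff measurableSet_ball).2 (integrableOn_const hν)
  refine h1.mono' χ.continuous.aestronglyMeasurable (Eventually.of_forall fun z => ?_)
  rw [Real.norm_of_nonneg χ.nonneg]
  by_cases hz : z ∈ ball x χ.rOut
  · rw [indicator_of_mem hz]
    exact χ.le_one
  · rw [indicator_of_notMem hz]
    exact (Function.notMem_support.1 (χ.support_eq.symm ▸ hz)).le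

theorem ContDiffBump.measureReal_ball_le_integral {n : ℕ} {x : Euc n} (χ : ContDiffBump x)
    (ν : Measure (Euc n)) (hν : ν (ball x χ.rOut) ≠ ⊤) :
    ν.real (ball x χ.rIn) ≤ ∫ z, χ z ∂ν := by
  rw [← integral_indicator_one measurableSet_ball]
  refine integral_mono ((integrable_indicator_iff measurableSet_ball).2
    (integrableOn_const (measure_ne_top_of_subset (ball_subset_ball χ.rIn_lt_rOut.le) hν)))
    (χ.integrable_of_measure_ball_ne_top ν hν) fun z => ?_
  by_cases hz : z ∈ ball x χ.rIn
  · rw [indicator_of_mem hz, χ.one_of_mem_closedBall (ball_subset_closedBall hz), Pi.one_apply]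
  · rw [indicator_of_notMem hz]
    exact χ.nonneg

theorem ContDiffBump.integral_le_measureReal_ball {n : ℕ} {x : Euc n} (χ : ContDiffBump x)
    (ν : Measure (Euc n)) (hν : ν (ball x χ.rOut) ≠ ⊤) :
    ∫ z, χ z ∂ν ≤ ν.real (ball x χ.rOut) := by
  rw [← integral_indicator_one measurableSet_ball]
  refine integral_mono (χ.integrable_of_measure_ball_ne_top ν hν)
    ((integrable_indicator_iff measurableSet_ball).2 (integrableOn_const hν)) fun z => ?_
  by_cases hz : z ∈ ball x χ.rOut
  · rw [indicator_of_mem hz, Pi.one_apply]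
    exact χ.le_one
  · rw [indicator_of_notMem hz]
    exact (Function.notMem_support.1 (χ.support_eq.symm ▸ hz)).le

theorem WeakStarOn.tendsto_integral_bump {n : ℕ} {H : Set (Euc n)} {μs : ℕ → Measure (Euc n)}
    {μ : Measure (Euc n)} (h : WeakStarOn Hᶜ μs μ) {x : Euc n} (χ : ContDiffBump x)
    (hχ : ENNReal.ofReal χ.rOut < infEDist x H) :
    Tendsto (fun j => ∫ z, χ z ∂(μs j)) atTop (𝓝 (∫ z, χ z ∂μ)) := by
  refine h χ χ.continuous χ.hasCompactSupport fun z hz hzH => ?_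
  rw [χ.tsupport_eq, mem_closedBall, dist_comm] at hz
  refine absurd (hχ.trans_le (infEDist_le_edist_of_mem hzH)) (not_lt.2 ?_)
  rw [edist_dist]
  exact ENNReal.ofReal_le_ofReal hz

theorem IsMinimizingSeq.exists_error {d n : ℕ} {P : Set (Set (Euc n))} {Kj : ℕ → Set (Euc n)}
    (hmin : IsMinimizingSeq d P Kj) (hfin : plateauInf d P ≠ ⊤) :
    ∃ ε : ℕ → ℝ, Tendsto ε atTop (𝓝 0) ∧ ∀ᶠ j in atTop, 0 ≤ ε j ∧ μH[(d : ℝ)] (Kj j) ≠ ⊤ ∧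
      μH[(d : ℝ)] (Kj j) ≤ plateauInf d P + ENNReal.ofReal (ε j) := by
  obtain ⟨hP, -, hlim⟩ := hmin
  refine ⟨fun j => (μH[(d : ℝ)] (Kj j)).toReal - (plateauInf d P).toReal, ?_, ?_⟩
  · have := ((ENNReal.tendsto_toReal hfin).comp hlim).sub_const (plateauInf d P).toReal
    rwa [sub_self] at this
  · filter_upwards [hlim.eventually_lt_const hfin.lt_top] with j hj
    have h1 : plateauInf d P ≤ μH[(d : ℝ)] (Kj j) := iInf₂_le _ (hP j)
    refine ⟨sub_nonneg.2 (ENNReal.toReal_mono hj.ne h1), hj.ne, ?_⟩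
    rw [ENNReal.ofReal_sub _ ENNReal.toReal_nonneg, ENNReal.ofReal_toReal hj.ne,
      ENNReal.ofReal_toReal hfin, add_tsub_cancel_of_le h1]

theorem measureReal_ball_le_of_weakStarOn {n d : ℕ} (hd : 1 ≤ d) {H : Set (Euc n)}
    {P : Set (Set (Euc n))} (hrect : ∀ K ∈ P, CountablyRectifiable d K)
    (hgood : IsGoodClass d H P) (hfin : plateauInf d P ≠ ⊤) {Kj : ℕ → Set (Euc n)}
    (hmin : IsMinimizingSeq d P Kj) {μ : Measure (Euc n)} [IsLocallyFiniteMeasure μ]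
    (hweak : WeakStarOn Hᶜ (fun j => μH[(d : ℝ)].restrict (Kj j)) μ) {x : Euc n}
    (hx : x ∈ sptMeas μ) {r₁ r₂ t : ℝ} (hr₁ : 0 < r₁) (ht : 0 < t) (hr : r₁ + 4 * t < r₂)
    (hr₂ : ENNReal.ofReal r₂ < infEDist x H) :
    μ.real (ball x r₁) ≤ ((r₁ + 2 * t) / (r₂ - 2 * t)) ^ d * μ.real (ball x r₂) := by
  have hμ : ∀ s, μ (ball x s) ≠ ⊤ := fun s => measure_ball_lt_top.ne
  obtain ⟨ε, hε, hεj⟩ := hmin.exists_error hfin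
  let χ₁ : ContDiffBump x := ⟨r₁, r₁ + t, hr₁, by linarith⟩
  let χ₂ : ContDiffBump x := ⟨r₂ - t, r₂, by linarith, by linarith⟩
  let χ₃ : ContDiffBump x := ⟨t / 2, t, by positivity, by linarith⟩
  have hlim₁ := hweak.tendsto_integral_bump χ₁
    ((ENNReal.ofReal_le_ofReal (by simp only [χ₁]; linarith)).trans_lt hr₂)
  have hlim₂ := hweak.tendsto_integral_bump χ₂ hr₂
  have hlim₃ := hweak.tendsto_integral_bump χ₃
    ((ENNReal.ofReal_le_ofReal (by simp only [χ₃]; linarith)).trans_lt hr₂)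
  have hpos : 0 < ∫ z, χ₃ z ∂μ :=
    (ENNReal.toReal_pos (hx (t / 2) (by positivity)).ne' (hμ _)).trans_le
      (χ₃.measureReal_ball_le_integral μ (hμ _))
  refine (χ₁.measureReal_ball_le_integral μ (hμ _)).trans (le_trans ?_
    (mul_le_mul_of_nonneg_left (χ₂.integral_le_measureReal_ball μ (hμ _))
      (pow_nonneg (div_nonneg (by linarith) (by linarith)) d)))
  have hlim := hε.add (hlim₂.const_mul (((r₁ + 2 * t) / (r₂ - 2 * t)) ^ d))
  rw [zero_add] at hlim
  refine le_of_tendsto_of_tendsto hlim₁ hlim ?_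
  filter_upwards [hεj, hlim₃.eventually_const_lt hpos] with j ⟨hε0, hK, hεK⟩ hj
  have hν : ∀ s, (μH[(d : ℝ)].restrict (Kj j)) (ball x s) ≠ ⊤ := fun s => by
    rw [Measure.restrict_apply measurableSet_ball]
    exact measure_ne_top_of_subset inter_subset_right hK
  have hreal : ∀ s, (μH[(d : ℝ)].restrict (Kj j)).real (ball x s) = ballMass d (Kj j) x s :=
    fun s => by rw [measureReal_def, Measure.restrict_apply measurableSet_ball, inter_comm, ballMass]
  obtain ⟨y, hyK, hyx⟩ : (Kj j ∩ ball x t).Nonempty := by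
    by_contra h
    have h1 := hj.trans_le (χ₃.integral_le_measureReal_ball _ (hν _))
    rw [hreal, ballMass, not_nonempty_iff_eq_empty.1 h, measure_empty] at h1
    exact lt_irrefl _ h1
  have hsub : ∀ (u v : Euc n) (s : ℝ), dist u v < t →
      ballMass d (Kj j) u s ≤ ballMass d (Kj j) v (s + t) := fun u v s huv =>
    ENNReal.toReal_mono (measure_ne_top_of_subset inter_subset_left hK)
      (measure_mono (inter_subset_inter_right _ (ball_subset_ball' (by linarith))))
  have hyH : ENNReal.ofReal (r₂ - 2 * t) < infEDist y H := by
    have h1 : infEDist x H ≤ infEDist y H + edist x y :=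
      infEDist_le_infEDist_add_edist
    have h2 : edist x y ≤ ENNReal.ofReal (2 * t) := by
      rw [edist_dist, dist_comm]
      exact ENNReal.ofReal_le_ofReal (by linarith [mem_ball.1 hyx])
    have h3 : ENNReal.ofReal (r₂ - 2 * t) + ENNReal.ofReal (2 * t) <
        infEDist y H + ENNReal.ofReal (2 * t) := by
      rw [← ENNReal.ofReal_add (by linarith) (by linarith), sub_add_cancel]
      exact hr₂.trans_le (h1.trans (by gcongr))
    exact lt_of_add_lt_add_right h3
  have hmain := hgood.ballMass_le hd (hmin.1 j) (hrect _ (hmin.1 j)) hK hε0 hεK hyK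
    (a := r₁ + 2 * t) (by linarith) (by linarith) hyH
  have h1 := (χ₁.integral_le_measureReal_ball _ (hν _)).trans_eq (hreal _)
  have h2 := (hreal _).symm.trans_le (χ₂.measureReal_ball_le_integral _ (hν _))
  have h3 := hsub x y (r₁ + t) (by rw [dist_comm]; exact hyx)
  have h4 := hsub y x (r₂ - 2 * t) hyx
  rw [show r₁ + t + t = r₁ + 2 * t by ring] at h3
  rw [show r₂ - 2 * t + t = r₂ - t by ring] at h4
  refine (h1.trans (h3.trans hmain)).trans ?_
  gcongr
  · exact pow_nonneg (div_nonneg (by linarith) (by linarith)) d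
  · exact h4.trans h2

theorem measure_ball_div_le_of_weakStarOn {n d : ℕ} (hd : 1 ≤ d) {H : Set (Euc n)}
    {P : Set (Set (Euc n))} (hrect : ∀ K ∈ P, CountablyRectifiable d K)
    (hgood : IsGoodClass d H P) (hfin : plateauInf d P ≠ ⊤) {Kj : ℕ → Set (Euc n)}
    (hmin : IsMinimizingSeq d P Kj) {μ : Measure (Euc n)} [IsLocallyFiniteMeasure μ]
    (hweak : WeakStarOn Hᶜ (fun j => μH[(d : ℝ)].restrict (Kj j)) μ) {x : Euc n}
    (hx : x ∈ sptMeas μ) {r₁ r₂ : ℝ} (hr₁ : 0 < r₁) (hr : r₁ ≤ r₂)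
    (hr₂ : ENNReal.ofReal r₂ < infEDist x H) :
    μ (ball x r₁) / ENNReal.ofReal r₁ ^ d ≤ μ (ball x r₂) / ENNReal.ofReal r₂ ^ d := by
  rcases hr.eq_or_lt with rfl | hlt
  · exact le_rfl
  have hr0 : 0 < r₂ := hr₁.trans hlt
  have hlim : Tendsto (fun t : ℝ => ((r₁ + 2 * t) / (r₂ - 2 * t)) ^ d * μ.real (ball x r₂))
      (𝓝[>] 0) (𝓝 ((r₁ / r₂) ^ d * μ.real (ball x r₂))) := by
    have : ContinuousAt (fun t : ℝ => ((r₁ + 2 * t) / (r₂ - 2 * t)) ^ d * μ.real (ball x r₂)) 0 := by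
      refine ((ContinuousAt.div (by fun_prop) (by fun_prop) ?_).pow d).mul continuousAt_const
      simpa using hr0.ne'
    have := this.tendsto.mono_left (nhdsWithin_le_nhds (s := Ioi 0))
    simpa using this
  have h1 := ge_of_tendsto hlim (by
    filter_upwards [Ioo_mem_nhdsGT (show (0 : ℝ) < (r₂ - r₁) / 4 by linarith)] with t ht
    exact measureReal_ball_le_of_weakStarOn hd hrect hgood hfin hmin hweak hx hr₁ ht.1
      (by linarith [ht.2]) hr₂)
  have hμ : ∀ s, μ (ball x s) ≠ ⊤ := fun s => measure_ball_lt_top.ne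
  rw [← ENNReal.ofReal_pow hr₁.le, ← ENNReal.ofReal_pow hr0.le, ← ENNReal.ofReal_toReal (hμ r₁),
    ← ENNReal.ofReal_toReal (hμ r₂), ← ENNReal.ofReal_div_of_pos (by positivity),
    ← ENNReal.ofReal_div_of_pos (by positivity)]
  refine ENNReal.ofReal_le_ofReal ?_
  rw [div_pow, div_mul_eq_mul_div] at h1
  rw [div_le_div_iff₀ (by positivity) (by positivity), ← le_div_iff₀ (by positivity)]
  refine h1.trans_eq ?_
  rw [mul_comm, measureReal_def]

theorem exists_hasDensityAt {n d : ℕ} {μ : Measure (Euc n)} {x : Euc n} {R : ℝ} (hR : 0 < R)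
    (h : ∀ r₁ r₂ : ℝ, 0 < r₁ → r₁ ≤ r₂ → r₂ < R →
      μ (ball x r₁) / ENNReal.ofReal r₁ ^ d ≤ μ (ball x r₂) / ENNReal.ofReal r₂ ^ d) :
    ∃ θ : ℝ≥0∞, HasDensityAt d μ x θ := by
  have hball : ballVol d ≠ 0 := (measure_ball_pos volume _ one_pos).ne'
  have hball' : ballVol d ≠ ⊤ := measure_ball_lt_top.ne
  have hmono : MonotoneOn (fun r : ℝ => μ (ball x r) / (ballVol d * ENNReal.ofReal r ^ d))
      (Ioo 0 R) := by
    intro r hr s hs hrs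
    simp only [div_eq_mul_inv]
    rw [ENNReal.mul_inv (Or.inl hball) (Or.inl hball'), ENNReal.mul_inv (Or.inl hball)
      (Or.inl hball'), mul_left_comm, mul_left_comm (μ (ball x s))]
    have := h r s hr.1 hrs hs.2
    simp only [div_eq_mul_inv] at this
    gcongr
  exact ⟨_, hmono.tendsto_nhdsWithin_Ioo_right (nonempty_Ioo.2 hR) (OrderBot.bddBelow _)⟩

/-- **Step two of Theorem 1 (monotonicity).** For any weak-* limit `μ` of `H^d ⌐ K_j`
along a minimizing sequence of a good class, the function `r ↦ μ(B(x,r))/r^d` is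
monotone increasing on `(0, dist(x,H))` for every `x ∈ spt μ ∖ H`; in particular the
`d`-dimensional density `θ(x)` exists at every such point. -/
theorem statement8 {n d : ℕ} (hd1 : 1 ≤ d) (hdn : d ≤ n)
    (H : Set (Euc n)) (hH : IsClosed H)
    (P : Set (Set (Euc n))) (hPstruct : ∀ K ∈ P, RelClosedIn Hᶜ K ∧ CountablyRectifiable d K)
    (hgood : IsGoodClass d H P) (hfin : plateauInf d P ≠ ⊤)
    (Kj : ℕ → Set (Euc n)) (hmin : IsMinimizingSeq d P Kj)
    (μ : Measure (Euc n)) [IsLocallyFiniteMeasure μ]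
    (hweak : WeakStarOn Hᶜ (fun j => μH[(d : ℝ)].restrict (Kj j)) μ) :
    ∀ x ∈ sptMeas μ \ H,
      (∀ r1 r2 : ℝ, 0 < r1 → r1 ≤ r2 → ENNReal.ofReal r2 < EMetric.infEdist x H →
        μ (ball x r1) / ENNReal.ofReal r1 ^ d ≤ μ (ball x r2) / ENNReal.ofReal r2 ^ d) ∧
      ∃ θ : ℝ≥0∞, HasDensityAt d μ x θ := by
  rintro x ⟨hx, hxH⟩
  have hmono : ∀ r1 r2 : ℝ, 0 < r1 → r1 ≤ r2 → ENNReal.ofReal r2 < infEDist x H →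
      μ (ball x r1) / ENNReal.ofReal r1 ^ d ≤ μ (ball x r2) / ENNReal.ofReal r2 ^ d :=
    fun r1 r2 h1 h2 h3 => measure_ball_div_le_of_weakStarOn hd1 (fun K hK => (hPstruct K hK).2)
      hgood hfin hmin hweak hx h1 h2 h3
  have hpos : 0 < infEDist x H :=
    infEDist_pos_iff_notMem_closure.2 (by rwa [hH.closure_eq])
  obtain ⟨R, hR0, hR⟩ := ENNReal.lt_iff_exists_nnreal_btwn.1 hpos
  refine ⟨hmono, exists_hasDensityAt (R := R) (by exact_mod_cast hR0) fun r1 r2 h1 h2 h3 =>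
    hmono r1 r2 h1 h2 (lt_of_le_of_lt ?_ hR)⟩
  rw [← ENNReal.ofReal_coe_nnreal]
  exact ENNReal.ofReal_le_ofReal h3.le
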